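/- arXiv:2404.17509 — 12 statements merged into one kernel-verified Lean document; each statement's English description precedes it below -/
import Mathlib

section
/- Let z be a cluster LP solution on a nonempty finite set V and let u, v, w be three distinct elements of V. Then 3·y_{uvw} ≤ y_{uv} + y_{uw} + y_{vw} ≤ 3/2 + (3/2)·y_{uvw}. -/
open Finset

variable {V : Type*} [Fintype V] [DecidableEq V]

/-- A cluster LP solution on `V`: a nonnegative weight on every nonempty subset of `V`
such that for every vertex `u`, the total weight of sets containing `u` is `1`. -/
def IsClusterLP (z : Finset V → ℝ) : Prop :=
  (∀ S : Finset V, S.Nonempty → 0 ≤ z S) ∧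
  (∀ u : V, ∑ S ∈ univ.filter (fun S : Finset V => u ∈ S), z S = 1)

/-- `y_{uv}`: total weight of sets containing both `u` and `v`. -/
noncomputable def yPair (z : Finset V → ℝ) (u v : V) : ℝ :=
  ∑ S ∈ univ.filter (fun S : Finset V => u ∈ S ∧ v ∈ S), z S

/-- `y_{uvw}`: total weight of sets containing `u`, `v` and `w`. -/
noncomputable def yTriple (z : Finset V → ℝ) (u v w : V) : ℝ :=
  ∑ S ∈ univ.filter (fun S : Finset V => u ∈ S ∧ v ∈ S ∧ w ∈ S), z S

theorem triple_vs_pair_bounds [Nonempty V] (z : Finset V → ℝ) (hz : IsClusterLP z)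
    (u v w : V) (huv : u ≠ v) (huw : u ≠ w) (hvw : v ≠ w) :
    3 * yTriple z u v w ≤ yPair z u v + yPair z u w + yPair z v w ∧
    yPair z u v + yPair z u w + yPair z v w ≤ 3 / 2 + 3 / 2 * yTriple z u v w := by
  obtain ⟨hnonneg, hsum⟩ := hz
  have hu := hsum u
  have hv := hsum v
  have hw := hsum w
  simp only [yTriple, yPair, sum_filter] at hu hv hw ⊢
  constructor
  · rw [mul_sum, ← sum_add_distrib, ← sum_add_distrib]
    refine sum_le_sum fun S _ => ?_
    by_cases h₁ : u ∈ S <;> by_cases h₂ : v ∈ S <;> by_cases h₃ : w ∈ S <;>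
      simp only [h₁, h₂, h₃, and_true, and_false, if_true, if_false] <;>
      first
        | linarith
        | linarith [hnonneg S ⟨_, h₁⟩]
        | linarith [hnonneg S ⟨_, h₂⟩]
  · have key : ∑ S : Finset V, 2 * ((if u ∈ S ∧ v ∈ S then z S else 0) +
          (if u ∈ S ∧ w ∈ S then z S else 0) + (if v ∈ S ∧ w ∈ S then z S else 0)) ≤
        ∑ S : Finset V, ((if u ∈ S then z S else 0) + (if v ∈ S then z S else 0) +
          (if w ∈ S then z S else 0) + 3 * (if u ∈ S ∧ v ∈ S ∧ w ∈ S then z S else 0)) := by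
      refine sum_le_sum fun S _ => ?_
      by_cases h₁ : u ∈ S <;> by_cases h₂ : v ∈ S <;> by_cases h₃ : w ∈ S <;>
        simp only [h₁, h₂, h₃, and_true, and_false, if_true, if_false] <;>
        first
          | linarith
          | linarith [hnonneg S ⟨_, h₁⟩]
          | linarith [hnonneg S ⟨_, h₂⟩]
          | linarith [hnonneg S ⟨_, h₃⟩]
    simp only [← mul_sum, sum_add_distrib] at key
    linarith
end

section
/- Let α ∈ [4/3, 2). For every correlation clustering instance on a nonempty finite set V, every cluster LP solution z on V, and every degenerate triangle T = (u,v) on two distinct vertices of V, one has cost(T) ≤ Delta(T), where cost and Delta are defined with parameter α and threshold τ = 0.4. -/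
open Finset
open scoped Classical

variable {V : Type*} [Fintype V] [DecidableEq V]

/-- `x_{uv} := 1 - y_{uv}`. -/
noncomputable def xPair (z : Finset V → ℝ) (u v : V) : ℝ :=
  1 - yPair z u v

/-- `budget^+_α(x) := (α/(1-α/2)) · x²/(1+x)`. -/
noncomputable def budgetPlus (α x : ℝ) : ℝ :=
  (α / (1 - α / 2)) * (x ^ 2 / (1 + x))

/-- `budget^-_α(x) := (α/(1-α/2)) · (1+2x)(1-x)/(2(1+x))`. -/
noncomputable def budgetMinus (α x : ℝ) : ℝ :=
  (α / (1 - α / 2)) * ((1 + 2 * x) * (1 - x) / (2 * (1 + x)))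

/-- `p_u(v)`: probability that `v` joins the cluster of pivot `u`.
It is `1` if `uv` is a short `+`pair (`x_{uv} ≤ 0.4`) and `y_{uv}` otherwise. -/
noncomputable def pPiv (z : Finset V → ℝ) (plus : V → V → Bool) (u v : V) : ℝ :=
  if plus u v = true ∧ xPair z u v ≤ 0.4 then 1 else yPair z u v

/-- `q_u(v,w)`: probability that both `v` and `w` join the cluster of pivot `u`.
It is `y_{uvw}` if `uv` and `uw` are both long `+`pairs, and `p_u(v)·p_u(w)` otherwise. -/
noncomputable def qPiv (z : Finset V → ℝ) (plus : V → V → Bool) (u v w : V) : ℝ :=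
  if (plus u v = true ∧ 0.4 < xPair z u v) ∧ (plus u w = true ∧ 0.4 < xPair z u w) then
    yTriple z u v w
  else pPiv z plus u v * pPiv z plus u w

/-- The budget `b_{vw}` of a pair. -/
noncomputable def bPair (z : Finset V → ℝ) (plus : V → V → Bool) (α : ℝ) (v w : V) : ℝ :=
  if plus v w = true then budgetPlus α (xPair z v w) else budgetMinus α (xPair z v w)

/-- `cost_u(v,w)`. -/
noncomputable def costPiv (z : Finset V → ℝ) (plus : V → V → Bool) (u v w : V) : ℝ :=
  if plus v w = true then pPiv z plus u v + pPiv z plus u w - 2 * qPiv z plus u v w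
  else qPiv z plus u v w

/-- `Delta_u(v,w)`. -/
noncomputable def deltaPiv (z : Finset V → ℝ) (plus : V → V → Bool) (α : ℝ) (u v w : V) : ℝ :=
  (pPiv z plus u v + pPiv z plus u w - qPiv z plus u v w) * bPair z plus α v w

/-- `cost(T)` for a triangle `T = (u,v,w)`. -/
noncomputable def costTri (z : Finset V → ℝ) (plus : V → V → Bool) (u v w : V) : ℝ :=
  costPiv z plus u v w + costPiv z plus v u w + costPiv z plus w u v

/-- `Delta(T)` for a triangle `T = (u,v,w)`. -/
noncomputable def deltaTri (z : Finset V → ℝ) (plus : V → V → Bool) (α : ℝ) (u v w : V) : ℝ :=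
  deltaPiv z plus α u v w + deltaPiv z plus α v u w + deltaPiv z plus α w u v

/-- `cost_u(u,v)` for a degenerate triangle. -/
noncomputable def costDegPiv (z : Finset V → ℝ) (plus : V → V → Bool) (u v : V) : ℝ :=
  if plus u v = true then 1 - pPiv z plus u v else pPiv z plus u v

/-- `cost(T)` for a degenerate triangle `T = (u,v)`. -/
noncomputable def costDeg (z : Finset V → ℝ) (plus : V → V → Bool) (u v : V) : ℝ :=
  costDegPiv z plus u v + costDegPiv z plus v u

/-- `Delta(T)` for a degenerate triangle `T = (u,v)`. -/
noncomputable def deltaDeg (z : Finset V → ℝ) (plus : V → V → Bool) (α : ℝ) (u v : V) : ℝ :=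
  2 * bPair z plus α u v

theorem yPair_comm (z : Finset V → ℝ) (u v : V) : yPair z u v = yPair z v u := by
  simp only [yPair, and_comm]

theorem xPair_comm (z : Finset V → ℝ) (u v : V) : xPair z u v = xPair z v u := by
  rw [xPair, xPair, yPair_comm]

theorem pPiv_comm (z : Finset V → ℝ) {plus : V → V → Bool}
    (hsym : ∀ a b : V, plus a b = plus b a) (u v : V) :
    pPiv z plus u v = pPiv z plus v u := by
  rw [pPiv, pPiv, yPair_comm z u v, xPair_comm z u v, hsym u v]

theorem IsClusterLP.yPair_nonneg {z : Finset V → ℝ} (hz : IsClusterLP z) (u v : V) :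
    0 ≤ yPair z u v :=
  Finset.sum_nonneg fun S hS => hz.1 S ⟨u, (Finset.mem_filter.1 hS).2.1⟩

theorem IsClusterLP.yPair_le_one {z : Finset V → ℝ} (hz : IsClusterLP z) (u v : V) :
    yPair z u v ≤ 1 := by
  rw [← hz.2 u]
  refine Finset.sum_le_sum_of_subset_of_nonneg ?_ fun S hS _ =>
    hz.1 S ⟨u, (Finset.mem_filter.1 hS).2⟩
  intro S hS
  simp only [Finset.mem_filter] at hS ⊢
  exact ⟨hS.1, hS.2.1⟩

theorem four_le_budget_factor {α : ℝ} (hα : α ∈ Set.Ico (4 / 3 : ℝ) 2) :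
    4 ≤ α / (1 - α / 2) := by
  obtain ⟨h₁, h₂⟩ := hα
  rw [le_div_iff₀ (by linarith)]
  linarith

theorem budgetPlus_nonneg {α x : ℝ} (hα : α ∈ Set.Ico (4 / 3 : ℝ) 2) (hx : 0 ≤ x) :
    0 ≤ budgetPlus α x :=
  mul_nonneg (by linarith [four_le_budget_factor hα]) (by positivity)

theorem le_budgetPlus {α x : ℝ} (hα : α ∈ Set.Ico (4 / 3 : ℝ) 2) (hx : 1 / 3 ≤ x) :
    x ≤ budgetPlus α x := by
  have hx0 : 0 ≤ x := by linarith
  calc x ≤ 4 * (x ^ 2 / (1 + x)) := by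
        rw [← mul_div_assoc, le_div_iff₀ (by linarith)]
        nlinarith
    _ ≤ budgetPlus α x :=
        mul_le_mul_of_nonneg_right (four_le_budget_factor hα) (by positivity)

theorem one_sub_le_budgetMinus {α x : ℝ} (hα : α ∈ Set.Ico (4 / 3 : ℝ) 2)
    (hx : 0 ≤ x) (hx1 : x ≤ 1) : 1 - x ≤ budgetMinus α x := by
  have hx2 : 0 ≤ 1 - x := by linarith
  calc 1 - x ≤ 4 * ((1 + 2 * x) * (1 - x) / (2 * (1 + x))) := by
        rw [← mul_div_assoc, le_div_iff₀ (by linarith)]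
        nlinarith [mul_nonneg hx hx2]
    _ ≤ budgetMinus α x :=
        mul_le_mul_of_nonneg_right (four_le_budget_factor hα) (by positivity)

theorem costDegPiv_le_bPair {α : ℝ} (hα : α ∈ Set.Ico (4 / 3 : ℝ) 2)
    (plus : V → V → Bool) {z : Finset V → ℝ} (hz : IsClusterLP z) (u v : V) :
    costDegPiv z plus u v ≤ bPair z plus α u v := by
  have hy0 := hz.yPair_nonneg u v
  have hy1 := hz.yPair_le_one u v
  have hx : xPair z u v = 1 - yPair z u v := rfl
  by_cases hp : plus u v = true
  · by_cases hs : xPair z u v ≤ 0.4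
    · simpa [costDegPiv, bPair, pPiv, hp, hs] using
        budgetPlus_nonneg hα (by linarith : 0 ≤ xPair z u v)
    · simp only [costDegPiv, bPair, pPiv, hp, hs, and_false, if_true, if_false, ← hx]
      exact le_budgetPlus hα (by norm_num at hs; linarith)
  · simp only [costDegPiv, bPair, pPiv, hp]
    simpa [hx] using one_sub_le_budgetMinus hα (x := xPair z u v) (by linarith) (by linarith)

theorem degenerate_triangle_cost_le_budget [Nonempty V]
    (α : ℝ) (hα : α ∈ Set.Ico (4 / 3 : ℝ) 2)
    (plus : V → V → Bool) (hsym : ∀ a b : V, plus a b = plus b a)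
    (z : Finset V → ℝ) (hz : IsClusterLP z)
    (u v : V) (huv : u ≠ v) :
    costDeg z plus u v ≤ deltaDeg z plus α u v := by
  have hcomm : costDegPiv z plus v u = costDegPiv z plus u v := by
    rw [costDegPiv, costDegPiv, pPiv_comm z hsym v u, hsym v u]
  rw [costDeg, deltaDeg, hcomm]
  linarith [costDegPiv_le_bPair hα plus hz u v]
end

section
/- Let α ∈ [1, 2). For every correlation clustering instance on a nonempty finite set V, every cluster LP solution z on V, and every triangle T = (u,v,w) on three distinct vertices of V all three of whose pairs uv, uw, vw are -pairs, one has cost(T) ≤ Delta(T), where cost and Delta are defined with parameter α and threshold τ = 0.4. -/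
open Finset
open scoped Classical

variable {V : Type*} [Fintype V] [DecidableEq V]

theorem le_budgetMinus_one_sub {α y : ℝ} (hα : α ∈ Set.Ico (1 : ℝ) 2) (h0 : 0 ≤ y) (h1 : y ≤ 1) :
    y ≤ budgetMinus α (1 - y) := by
  obtain ⟨hα1, hα2⟩ := hα
  have hk : 2 ≤ α / (1 - α / 2) := by
    rw [le_div_iff₀ (by linarith)]
    linarith
  have hy : y / 2 ≤ (1 + 2 * (1 - y)) * (1 - (1 - y)) / (2 * (1 + (1 - y))) := by
    rw [le_div_iff₀ (by linarith)]
    nlinarith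
  calc y = 2 * (y / 2) := by ring
    _ ≤ budgetMinus α (1 - y) := mul_le_mul hk hy (by linarith) (by linarith)

/-- The polynomial inequality that remains once every budget is bounded below by its `y`-value. -/
theorem sum_mul_le_sum_union_mul {a b c : ℝ} (ha : 0 ≤ a) (ha1 : a ≤ 1) (hb : 0 ≤ b)
    (hb1 : b ≤ 1) (hc : 0 ≤ c) (hc1 : c ≤ 1) :
    a * b + a * c + b * c ≤ (a + b - a * b) * c + (a + c - a * c) * b + (b + c - b * c) * a := by
  nlinarith [mul_nonneg (mul_nonneg ha hb) (sub_nonneg.2 hc1),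
    mul_nonneg (mul_nonneg ha hc) (sub_nonneg.2 hb1),
    mul_nonneg (mul_nonneg hb hc) (sub_nonneg.2 ha1)]

theorem mmm_triangle_cost_le_budget [Nonempty V]
    (α : ℝ) (hα : α ∈ Set.Ico (1 : ℝ) 2)
    (plus : V → V → Bool) (hsym : ∀ a b : V, plus a b = plus b a)
    (z : Finset V → ℝ) (hz : IsClusterLP z)
    (u v w : V) (huv : u ≠ v) (huw : u ≠ w) (hvw : v ≠ w)
    (hpuv : plus u v = false) (hpuw : plus u w = false) (hpvw : plus v w = false) :
    costTri z plus u v w ≤ deltaTri z plus α u v w := by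
  have hvu := (hsym v u).trans hpuv
  have hwu := (hsym w u).trans hpuw
  have hwv := (hsym w v).trans hpvw
  simp only [costTri, deltaTri, costPiv, deltaPiv, qPiv, pPiv, bPair, xPair, hpuv, hpuw, hpvw,
    hvu, hwu, hwv, Bool.false_eq_true, false_and, if_false]
  rw [yPair_comm z v u, yPair_comm z w u, yPair_comm z w v]
  have ha := hz.yPair_nonneg u v
  have ha1 := hz.yPair_le_one u v
  have hb := hz.yPair_nonneg u w
  have hb1 := hz.yPair_le_one u w
  have hc := hz.yPair_nonneg v w
  have hc1 := hz.yPair_le_one v w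
  generalize yPair z u v = a at *
  generalize yPair z u w = b at *
  generalize yPair z v w = c at *
  refine (sum_mul_le_sum_union_mul ha ha1 hb hb1 hc hc1).trans ?_
  refine add_le_add (add_le_add ?_ ?_) ?_ <;>
    exact mul_le_mul_of_nonneg_left (le_budgetMinus_one_sub hα ‹_› ‹_›) (by nlinarith)
end

section
/- Let α = 1.56. For every correlation clustering instance on a nonempty finite set V, every cluster LP solution z on V, and every triangle T = (u,v,w) on three distinct vertices of V exactly two of whose pairs uv, uw, vw are +pairs (the third being a -pair), one has cost(T) ≤ Delta(T), where cost and Delta are defined with parameter α and threshold τ = 0.4. -/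
open Finset
open scoped Classical

variable {V : Type*} [Fintype V] [DecidableEq V]

theorem budgetPlus_ge_tangent {x a : ℝ} (hx : 0 ≤ x) (ha : 0 ≤ a) :
    78 / 11 * (a ^ 2 / (1 + a) + (a ^ 2 + 2 * a) / (1 + a) ^ 2 * (x - a)) ≤
      budgetPlus 1.56 x := by
  have key : x ^ 2 / (1 + x) - (a ^ 2 / (1 + a) + (a ^ 2 + 2 * a) / (1 + a) ^ 2 * (x - a)) =
      (x - a) ^ 2 / ((1 + x) * (1 + a) ^ 2) := by
    field_simp
    ring
  have hnonneg : 0 ≤ (x - a) ^ 2 / ((1 + x) * (1 + a) ^ 2) := by positivity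
  unfold budgetPlus
  norm_num
  linarith

theorem budgetMinus_ge_quadratic {m : ℝ} (hm : 0 ≤ m) :
    78 / 11 * ((1 - m) * (2 + m) / 4) ≤ budgetMinus 1.56 m := by
  have key : (1 + 2 * m) * (1 - m) / (2 * (1 + m)) - (1 - m) * (2 + m) / 4 =
      m * (1 - m) ^ 2 / (4 * (1 + m)) := by
    field_simp
    ring
  have hnonneg : 0 ≤ m * (1 - m) ^ 2 / (4 * (1 + m)) := by positivity
  unfold budgetMinus
  norm_num
  linarith

theorem short_short_bound {x y m : ℝ} (hx : 0 ≤ x) (hy : 0 ≤ y) (hm : 0 ≤ m)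
    (hx4 : x ≤ 0.4) (hy4 : y ≤ 0.4) (hm1 : m ≤ 1) (hxy : m ≤ x + y) :
    1 + 2 * m ≤ budgetMinus 1.56 m + budgetPlus 1.56 x + budgetPlus 1.56 y := by
  have h1 := budgetPlus_ge_tangent hx (a := 0.4) (by norm_num)
  have h2 := budgetPlus_ge_tangent hy (a := 0.4) (by norm_num)
  have h3 := budgetMinus_ge_quadratic hm
  norm_num at h1 h2 hx4 hy4
  nlinarith

theorem short_long_bound {x y m : ℝ} (hx : 0 ≤ x) (hm : 0 ≤ m)
    (hx4 : x ≤ 0.4) (hy4 : 0.4 < y) (hy1 : y ≤ 1) (hm1 : m ≤ 1) (hxy : m ≤ x + y) :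
    1 + 2 * (1 - y) * m ≤
      budgetMinus 1.56 m + budgetPlus 1.56 y + (1 - y * m) * budgetPlus 1.56 x := by
  have h1 := budgetPlus_ge_tangent hx (a := 0.4) (by norm_num)
  have h2 := budgetPlus_ge_tangent (x := y) (by linarith) (a := 0.6) (by norm_num)
  have h3 := budgetMinus_ge_quadratic hm
  have hym : 0 ≤ 1 - y * m := by nlinarith
  have h4 := mul_le_mul_of_nonneg_left h1 hym
  norm_num at h1 h2 h4 hx4 hy4
  have h5 : (1 - y * m) * (78 / 11 * (4 / 35 + 24 / 49 * (m - y - 2 / 5))) ≤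
      (1 - y * m) * (78 / 11 * (4 / 35 + 24 / 49 * (x - 2 / 5))) := by
    gcongr
    linarith
  nlinarith [mul_nonneg hm (sub_nonneg.2 hm1), mul_nonneg (sub_nonneg.2 hy1) (sub_nonneg.2 hm1)]

theorem long_long_bound {f g h t : ℝ} (hf : 0 ≤ f) (hg : 0 ≤ g) (hh : 0 ≤ h)
    (hf6 : f < 0.6) (hg6 : g < 0.6) (hh1 : h ≤ 1)
    (htf : t ≤ f) (htg : t ≤ g) (hth : t ≤ h) (hfg : f + g - t ≤ 1) :
    t + (f + h - 2 * (f * h)) + (g + h - 2 * (g * h)) ≤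
      (f + g - t) * budgetMinus 1.56 (1 - h) + (f + h - f * h) * budgetPlus 1.56 (1 - g) +
        (g + h - g * h) * budgetPlus 1.56 (1 - f) := by
  norm_num at hf6 hg6
  have h1 := budgetPlus_ge_tangent (x := 1 - g) (by linarith) (a := 0.5) (by norm_num)
  have h2 := budgetPlus_ge_tangent (x := 1 - f) (by linarith) (a := 0.5) (by norm_num)
  have h3 := budgetMinus_ge_quadratic (m := 1 - h) (by linarith)
  have h3' : 78 / 11 * (h / 2) ≤ budgetMinus 1.56 (1 - h) := by nlinarith
  have k1 := mul_le_mul_of_nonneg_left h1 (show 0 ≤ f + h - f * h by nlinarith)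
  have k2 := mul_le_mul_of_nonneg_left h2 (show 0 ≤ g + h - g * h by nlinarith)
  have k3 := mul_le_mul_of_nonneg_left h3' (show 0 ≤ f + g - t by linarith)
  have hsq : f * g * (1 - h) ≤ (f + g) ^ 2 / 4 * (1 - h) := by
    gcongr
    nlinarith [sq_nonneg (f - g)]
  norm_num at k1 k2 k3
  obtain ⟨s, hs⟩ : ∃ s, s = f + g := ⟨_, rfl⟩
  have poly : t + s + 2 * h - 2 * h * s ≤ 78 / 11 * ((s - t) * h / 2 +
      (4 * s + 8 * h - 9 * h * s) / 9 - 5 / 18 * s ^ 2 * (1 - h)) := by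
    have hs0 : 0 ≤ s := by linarith
    have hs1 : s ≤ 6 / 5 := by linarith
    have hs2 : s ≤ 1 + h := by linarith
    rcases le_total h (s / 2) with hc | hc
    · have aux : t * (1 + 39 / 11 * h) ≤ h * (1 + 39 / 11 * h) := by gcongr
      nlinarith [mul_nonneg hh hs0, mul_nonneg hh (sub_nonneg.2 hs1),
        mul_nonneg (mul_nonneg (sub_nonneg.2 hc) (sub_nonneg.2 hs1)) (sub_nonneg.2 hh1),
        mul_nonneg (mul_nonneg (sub_nonneg.2 hc) (sub_nonneg.2 hs2)) (sub_nonneg.2 hh1),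
        mul_nonneg (sub_nonneg.2 hc) (sub_nonneg.2 hs2),
        mul_nonneg (sub_nonneg.2 hc) (sub_nonneg.2 hs1),
        mul_nonneg hs0 (sub_nonneg.2 hs2), mul_nonneg hs0 (sub_nonneg.2 hs1)]
    · have aux : t * (1 + 39 / 11 * h) ≤ s / 2 * (1 + 39 / 11 * h) := by
        gcongr
        linarith
      nlinarith [mul_nonneg hh hs0, mul_nonneg hs0 (sub_nonneg.2 hs1),
        mul_nonneg hs0 (sub_nonneg.2 hh1),
        mul_nonneg (mul_nonneg hs0 (sub_nonneg.2 hs1)) (sub_nonneg.2 hh1),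
        mul_nonneg (sub_nonneg.2 hc) (sub_nonneg.2 hs1),
        mul_nonneg (sub_nonneg.2 hc) (sub_nonneg.2 hh1)]
  subst hs
  nlinarith

theorem yTriple_swap_left (z : Finset V → ℝ) (u v w : V) :
    yTriple z u v w = yTriple z v u w := by
  simp only [yTriple, and_left_comm]

theorem yTriple_swap_right (z : Finset V → ℝ) (u v w : V) :
    yTriple z u v w = yTriple z u w v := by
  simp only [yTriple, and_comm]

theorem IsClusterLP.yTriple_le_yPair {z : Finset V → ℝ} (hz : IsClusterLP z) (u v w : V) :
    yTriple z u v w ≤ yPair z u v := by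
  refine Finset.sum_le_sum_of_subset_of_nonneg ?_ ?_
  · intro S
    simp +contextual
  · intro S hS _
    exact hz.1 S ⟨u, (Finset.mem_filter.1 hS).2.1⟩

theorem IsClusterLP.yPair_add_yPair_le {z : Finset V → ℝ} (hz : IsClusterLP z) (u v w : V) :
    yPair z u v + yPair z u w ≤ 1 + yTriple z u v w := by
  rw [← hz.2 u]
  simp only [yPair, yTriple, Finset.sum_filter, ← Finset.sum_add_distrib]
  refine Finset.sum_le_sum fun S _ => ?_
  by_cases hu : u ∈ S
  · have := hz.1 S ⟨u, hu⟩
    by_cases hv : v ∈ S <;> by_cases hw : w ∈ S <;> simp [hu, hv, hw, this]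
  · simp [hu]

theorem costPiv_comm (z : Finset V → ℝ) {plus : V → V → Bool}
    (hsym : ∀ a b, plus a b = plus b a) (u v w : V) :
    costPiv z plus u v w = costPiv z plus u w v := by
  simp only [costPiv, qPiv, hsym v w, yTriple_swap_right z u v w, add_comm (pPiv z plus u v),
    mul_comm (pPiv z plus u v), and_comm (a := plus u v = true ∧ 0.4 < xPair z u v)]

theorem deltaPiv_comm (z : Finset V → ℝ) {plus : V → V → Bool}
    (hsym : ∀ a b, plus a b = plus b a) (α : ℝ) (u v w : V) :
    deltaPiv z plus α u v w = deltaPiv z plus α u w v := by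
  simp only [deltaPiv, qPiv, bPair, hsym v w, xPair_comm z v w, yTriple_swap_right z u v w,
    add_comm (pPiv z plus u v), mul_comm (pPiv z plus u v),
    and_comm (a := plus u v = true ∧ 0.4 < xPair z u v)]

theorem costTri_le_deltaTri_of_center {z : Finset V → ℝ} (hz : IsClusterLP z)
    {plus : V → V → Bool} (hsym : ∀ a b, plus a b = plus b a) {c a b : V}
    (hca : plus c a = true) (hcb : plus c b = true) (hab : plus a b = false) :
    costTri z plus c a b ≤ deltaTri z plus 1.56 c a b := by
  have hac : plus a c = true := hsym a c ▸ hca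
  have hbc : plus b c = true := hsym b c ▸ hcb
  have hba : plus b a = false := hsym b a ▸ hab
  have f0 := hz.yPair_nonneg c a
  have g0 := hz.yPair_nonneg c b
  have h0 := hz.yPair_nonneg a b
  have f1 := hz.yPair_le_one c a
  have g1 := hz.yPair_le_one c b
  have h1 := hz.yPair_le_one a b
  have tf := hz.yTriple_le_yPair c a b
  have tg := hz.yTriple_le_yPair c b a
  have th := hz.yTriple_le_yPair a b c
  have hfg := hz.yPair_add_yPair_le c a b
  rw [← yTriple_swap_right] at tg
  rw [yTriple_swap_right, ← yTriple_swap_left] at th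
  have xa : xPair z c a = 1 - yPair z c a := rfl
  have xb : xPair z c b = 1 - yPair z c b := rfl
  have xm : xPair z a b = 1 - yPair z a b := rfl
  simp only [costTri, deltaTri, costPiv, deltaPiv, qPiv, pPiv, bPair, hca, hcb, hab, hac, hbc, hba,
    xPair_comm z a c, xPair_comm z b c, xPair_comm z b a,
    yPair_comm z a c, yPair_comm z b c, yPair_comm z b a,
    true_and, false_and, and_false, Bool.false_eq_true, if_true, if_false]
  by_cases ha : xPair z c a ≤ 0.4 <;> by_cases hb : xPair z c b ≤ 0.4
  · have := short_short_bound (x := xPair z c a) (y := xPair z c b) (m := xPair z a b)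
      (by linarith) (by linarith) (by linarith) ha hb (by linarith) (by linarith)
    simp only [ha, hb, not_lt.2 ha, not_lt.2 hb, if_true, if_false, and_self]
    linarith
  · have := short_long_bound (x := xPair z c a) (y := xPair z c b) (m := xPair z a b)
      (by linarith) (by linarith) ha (not_le.1 hb) (by linarith) (by linarith) (by linarith)
    simp only [ha, hb, not_lt.2 ha, if_true, if_false, false_and]
    rw [xb, xm] at *
    linarith
  · have := short_long_bound (x := xPair z c b) (y := xPair z c a) (m := xPair z a b)
      (by linarith) (by linarith) hb (not_le.1 ha) (by linarith) (by linarith) (by linarith)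
    simp only [ha, hb, not_lt.2 hb, if_true, if_false, and_false]
    rw [xa, xm] at *
    linarith
  · have hal := not_le.1 ha
    have hbl := not_le.1 hb
    simp only [ha, hb, hal, hbl, if_true, if_false, and_self]
    norm_num [xa] at hal
    norm_num [xb] at hbl
    have := long_long_bound f0 g0 h0 (by norm_num; linarith) (by norm_num; linarith) h1 tf tg th
      (by linarith)
    rw [← xa, ← xb, ← xm] at this
    linarith

theorem ppm_triangle_cost_le_budget [Nonempty V]
    (α : ℝ) (hα : α = 1.56)
    (plus : V → V → Bool) (hsym : ∀ a b : V, plus a b = plus b a)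
    (z : Finset V → ℝ) (hz : IsClusterLP z)
    (u v w : V) (huv : u ≠ v) (huw : u ≠ w) (hvw : v ≠ w)
    (htwo : (plus u v = true ∧ plus u w = true ∧ plus v w = false) ∨
            (plus u v = true ∧ plus v w = true ∧ plus u w = false) ∨
            (plus u w = true ∧ plus v w = true ∧ plus u v = false)) :
    costTri z plus u v w ≤ deltaTri z plus α u v w := by
  subst hα
  rcases htwo with ⟨h1, h2, h3⟩ | ⟨h1, h2, h3⟩ | ⟨h1, h2, h3⟩
  · exact costTri_le_deltaTri_of_center hz hsym h1 h2 h3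
  · have := costTri_le_deltaTri_of_center hz hsym (hsym u v ▸ h1) h2 h3
    simp only [costTri, deltaTri] at this ⊢
    rw [costPiv_comm z hsym w u v, deltaPiv_comm z hsym 1.56 w u v]
    linarith
  · have := costTri_le_deltaTri_of_center hz hsym (hsym u w ▸ h1) (hsym v w ▸ h2) h3
    simp only [costTri, deltaTri] at this ⊢
    rw [costPiv_comm z hsym u v w, deltaPiv_comm z hsym 1.56 u v w,
      costPiv_comm z hsym v u w, deltaPiv_comm z hsym 1.56 v u w]
    linarith
end

section
/- Let z be a cluster LP solution on a nonempty finite set V, and for every subset S ⊆ V define y_S := sum of z(S') over all nonempty S' ⊆ V with S' ⊇ S. Let T be a nonempty subset of V. Then the V × V real matrix M defined by M(u,v) := y_{T∪{u,v}} − y_{T∪{u}}·y_{T∪{v}} is symmetric positive semidefinite. -/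
open Finset

variable {V : Type*} [Fintype V] [DecidableEq V]

/-- `y_S`: total weight of nonempty sets containing `S` as a subset. -/
noncomputable def ySet (z : Finset V → ℝ) (S : Finset V) : ℝ :=
  ∑ S' ∈ univ.filter (fun S' : Finset V => S'.Nonempty ∧ S ⊆ S'), z S'

/-- The covariance matrix of a finite family of real random variables with respect to a
subprobability weight is positive semidefinite. -/
theorem posSemidef_covariance_of_sum_le_one {ι n : Type*} [Fintype n] (s : Finset ι)
    (w : ι → ℝ) (a : ι → n → ℝ) (hw : ∀ i ∈ s, 0 ≤ w i) (hw1 : ∑ i ∈ s, w i ≤ 1) :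
    (Matrix.of fun u v : n =>
      ∑ i ∈ s, w i * (a i u * a i v) -
        (∑ i ∈ s, w i * a i u) * ∑ i ∈ s, w i * a i v).PosSemidef := by
  refine Matrix.PosSemidef.of_dotProduct_mulVec_nonneg ?_ fun x => ?_
  · ext u v
    simp [mul_comm]
  · have hlin : ∑ u, x u * ∑ i ∈ s, w i * a i u = ∑ i ∈ s, w i * ∑ u, x u * a i u := by
      simp_rw [mul_sum]
      rw [sum_comm]
      exact sum_congr rfl fun i _ => sum_congr rfl fun u _ => by ring
    have hquad : ∑ u, ∑ v, x u * ((∑ i ∈ s, w i * (a i u * a i v)) * x v) =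
        ∑ i ∈ s, w i * (∑ u, x u * a i u) ^ 2 := by
      simp_rw [sq, sum_mul_sum, mul_sum, sum_mul, mul_sum]
      rw [sum_comm (s := s)]
      refine sum_congr rfl fun u _ => ?_
      rw [sum_comm (s := s)]
      exact sum_congr rfl fun v _ => sum_congr rfl fun i _ => by ring
    have hform : star x ⬝ᵥ (Matrix.of fun u v : n =>
        ∑ i ∈ s, w i * (a i u * a i v) -
          (∑ i ∈ s, w i * a i u) * ∑ i ∈ s, w i * a i v).mulVec x =
        ∑ i ∈ s, w i * (∑ u, x u * a i u) ^ 2 - (∑ i ∈ s, w i * ∑ u, x u * a i u) ^ 2 := by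
      rw [← hquad, ← hlin, sq, sum_mul_sum, ← sum_sub_distrib]
      simp only [dotProduct, Matrix.mulVec, Matrix.of_apply, star_trivial, mul_sum (s := univ),
        ← sum_sub_distrib]
      exact sum_congr rfl fun u _ => sum_congr rfl fun v _ => by ring
    rw [hform, sub_nonneg]
    calc (∑ i ∈ s, w i * ∑ u, x u * a i u) ^ 2
        ≤ (∑ i ∈ s, w i) * ∑ i ∈ s, w i * (∑ u, x u * a i u) ^ 2 :=
          sum_sq_le_sum_mul_sum_of_sq_le_mul s hw
            (fun i hi => mul_nonneg (hw i hi) (sq_nonneg _)) fun i _ => le_of_eq (by ring)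
      _ ≤ ∑ i ∈ s, w i * (∑ u, x u * a i u) ^ 2 :=
          mul_le_of_le_one_left
            (sum_nonneg fun i hi => mul_nonneg (hw i hi) (sq_nonneg _)) hw1

theorem ySet_le_one {z : Finset V → ℝ} (hz : IsClusterLP z) {T : Finset V}
    (hT : T.Nonempty) : ySet z T ≤ 1 := by
  obtain ⟨t, ht⟩ := hT
  rw [← hz.2 t]
  refine sum_le_sum_of_subset_of_nonneg (fun S hS => ?_) fun S hS _ => ?_
  · simp only [mem_filter_univ] at hS ⊢
    exact hS.2 ht
  · simp only [mem_filter_univ] at hS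
    exact hz.1 S ⟨t, hS⟩

theorem ySet_union (z : Finset V → ℝ) (T U : Finset V) :
    ySet z (T ∪ U) = ∑ S ∈ univ.filter (fun S : Finset V => S.Nonempty ∧ T ⊆ S),
      z S * if U ⊆ S then 1 else 0 := by
  simp only [ySet, mul_ite, mul_one, mul_zero, ← sum_filter, filter_filter, union_subset_iff,
    and_assoc]

theorem covariance_matrix_posSemidef [Nonempty V]
    (z : Finset V → ℝ) (hz : IsClusterLP z)
    (T : Finset V) (hT : T.Nonempty) :
    (Matrix.of fun u v : V =>
        ySet z (T ∪ {u, v}) - ySet z (T ∪ {u}) * ySet z (T ∪ {v})).PosSemidef := by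
  have h := posSemidef_covariance_of_sum_le_one
    (univ.filter fun S : Finset V => S.Nonempty ∧ T ⊆ S) z
    (fun S u => if u ∈ S then 1 else 0)
    (fun S hS => hz.1 S (mem_filter.mp hS).2.1) (ySet_le_one hz hT)
  convert h using 7 with u v
  · simp only [ySet_union, insert_subset_iff, singleton_subset_iff, ite_and, ite_mul, one_mul,
      zero_mul]
  · simp only [ySet_union, singleton_subset_iff]
  · simp only [ySet_union, singleton_subset_iff]
end

section
/- For every ε > 0, there exist a correlation clustering instance on a nonempty finite set V and a cluster LP solution z on V such that the LP objective obj_LP := (sum over +pairs uv of x_{uv}) + (sum over -pairs uv of (1 − x_{uv})) is positive, and every partition 𝒞 of V satisfies obj(𝒞) ≥ (4/3 − ε)·obj_LP. In other words, the integrality gap of the cluster LP is at least 4/3 − ε. -/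
open Finset
open scoped Classical

variable {V : Type*} [Fintype V] [DecidableEq V]

/-- The LP objective: the sum over `+`pairs `uv` of `x_{uv}` plus the sum over `-`pairs `uv`
of `1 - x_{uv}` (each unordered pair counted once, via ordered pairs divided by two). -/
noncomputable def objLP (plus : V → V → Bool) (z : Finset V → ℝ) : ℝ :=
  (∑ p ∈ (univ : Finset (V × V)).filter (fun p => p.1 ≠ p.2),
      if plus p.1 p.2 = true then xPair z p.1 p.2 else 1 - xPair z p.1 p.2) / 2

/-- Two vertices lie in the same part of the partition `P`. -/
def SamePart (P : Finpartition (univ : Finset V)) (u v : V) : Prop :=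
  ∃ t ∈ P.parts, u ∈ t ∧ v ∈ t

/-- The cost of a clustering (partition) `P`: the number of `+`pairs whose endpoints lie in
different parts plus the number of `-`pairs whose endpoints lie in the same part
(each unordered pair counted once, via ordered pairs divided by two). -/
noncomputable def objClust (plus : V → V → Bool) (P : Finpartition (univ : Finset V)) : ℝ :=
  ((((univ : Finset (V × V)).filter
        (fun p => p.1 ≠ p.2 ∧ plus p.1 p.2 = true ∧ ¬ SamePart P p.1 p.2)).card : ℝ) +
    (((univ : Finset (V × V)).filter
        (fun p => p.1 ≠ p.2 ∧ plus p.1 p.2 = false ∧ SamePart P p.1 p.2)).card : ℝ)) / 2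

section EdgeClusters

set_option linter.unusedSectionVars false

variable {α : Type*} [Fintype α] [DecidableEq α] {E : V → Finset α}

lemma sum_sum_card_inter (E : V → Finset α) (s t : Finset V) :
    ∑ u ∈ s, ∑ v ∈ t, #(E u ∩ E v) =
      ∑ a, #{u ∈ s | a ∈ E u} * #{v ∈ t | a ∈ E v} := by
  have h : ∀ u v, #(E u ∩ E v) = ∑ a, (if a ∈ E u then 1 else 0) * (if a ∈ E v then 1 else 0) := by
    intro u v
    rw [← filter_univ_mem (E u ∩ E v), card_filter]
    refine sum_congr rfl fun a _ => ?_
    by_cases h₁ : a ∈ E u <;> by_cases h₂ : a ∈ E v <;> simp [h₁, h₂]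
  simp_rw [h, card_filter, sum_mul_sum]
  rw [sum_comm (s := univ) (t := s)]
  exact sum_congr rfl fun u _ => sum_comm

lemma card_inter_le (hE : Function.Injective E) (hcard : ∀ u, #(E u) = 2) (u v : V) :
    #(E u ∩ E v) ≤ 1 + if u = v then 1 else 0 := by
  split_ifs with h
  · subst h; simp [hcard]
  · by_contra! hlt
    have h₁ : E u ∩ E v = E u := eq_of_subset_of_card_le inter_subset_left (by rw [hcard]; omega)
    have h₂ : E u ∩ E v = E v := eq_of_subset_of_card_le inter_subset_right (by rw [hcard]; omega)
    exact h (hE (h₁.symm.trans h₂))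

lemma card_filter_mem_le (hE : Function.Injective E) (hcard : ∀ u, #(E u) = 2) {a c : α}
    (hac : a ≠ c) (t : Finset V) : #{v ∈ t | a ∈ E v ∧ c ∈ E v} ≤ 1 := by
  refine card_le_one.2 fun u hu v hv => hE ?_
  simp only [mem_filter] at hu hv
  have key : ∀ w, a ∈ E w → c ∈ E w → {a, c} = E w := fun w ha hc =>
    eq_of_subset_of_card_le (by simp [insert_subset_iff, ha, hc]) (by rw [hcard, card_pair hac])
  exact (key u hu.2.1 hu.2.2).symm.trans (key v hv.2.1 hv.2.2)

lemma exists_center [Nonempty α] (hE : Function.Injective E) (hcard : ∀ u, #(E u) = 2)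
    (t : Finset V) : ∃ c : α, 2 * ∑ u ∈ t, ∑ v ∈ t, #(E u ∩ E v) ≤
      #t ^ 2 + #{u ∈ t | c ∈ E u} ^ 2 + 10 * #t := by
  obtain ⟨c, hc⟩ := Finite.exists_max fun a => #{u ∈ t | a ∈ E u}
  refine ⟨c, ?_⟩
  have row : ∀ s u, ∑ v ∈ s, #(E u ∩ E v) = ∑ a ∈ E u, #{v ∈ s | a ∈ E v} := by
    intro s u
    simp_rw [card_filter]
    rw [sum_comm]
    refine sum_congr rfl fun v _ => ?_
    rw [← card_filter, filter_mem_eq_inter]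
  have row_le : ∀ s u, ∑ v ∈ s, #(E u ∩ E v) ≤ #s + 1 := by
    intro s u
    calc _ ≤ ∑ v ∈ s, (1 + if u = v then 1 else 0) :=
          sum_le_sum fun v _ => card_inter_le hE hcard u v
      _ ≤ _ := by
          rw [sum_add_distrib, sum_ite_eq]
          split_ifs <;> simp
  have row_le_center : ∀ u, ∑ v ∈ t, #(E u ∩ E v) ≤ 2 * #{u ∈ t | c ∈ E u} := by
    intro u
    rw [row, ← hcard u, ← smul_eq_mul]
    exact sum_le_card_nsmul _ _ _ fun a _ => hc a
  set A := {u ∈ t | c ∈ E u} with hA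
  set B := {u ∈ t | c ∉ E u} with hB
  have split : ∀ f : V → ℕ, ∑ u ∈ t, f u = ∑ u ∈ A, f u + ∑ u ∈ B, f u := fun f =>
    (sum_filter_add_sum_filter_not t _ f).symm
  have hm : #t = #A + #B := (card_filter_add_card_filter_not _).symm
  have hBA : ∑ u ∈ B, ∑ v ∈ A, #(E u ∩ E v) ≤ #B * 2 := by
    rw [← smul_eq_mul]
    refine sum_le_card_nsmul _ _ _ fun u hu => ?_
    rw [row, ← hcard u, ← mul_one #(E u), ← smul_eq_mul]
    refine sum_le_card_nsmul _ _ _ fun a ha => ?_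
    have hac : a ≠ c := by
      rintro rfl
      exact (mem_filter.1 hu).2 ha
    rw [hA, filter_filter]
    simpa only [and_comm] using card_filter_mem_le hE hcard hac t
  have hAB : ∑ u ∈ A, ∑ v ∈ B, #(E u ∩ E v) ≤ #B * 2 := by
    rw [sum_comm]
    simpa only [inter_comm] using hBA
  have hAA : ∑ u ∈ A, ∑ v ∈ A, #(E u ∩ E v) ≤ #A * (#A + 1) := by
    rw [← smul_eq_mul]
    exact sum_le_card_nsmul _ _ _ fun u _ => row_le A u
  have hBB : ∑ u ∈ B, ∑ v ∈ B, #(E u ∩ E v) ≤ #B * (#B + 1) := by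
    rw [← smul_eq_mul]
    exact sum_le_card_nsmul _ _ _ fun u _ => row_le B u
  have hBB' : ∑ u ∈ B, ∑ v ∈ B, #(E u ∩ E v) ≤ #B * (2 * #A) := by
    rw [← smul_eq_mul]
    exact sum_le_card_nsmul _ _ _ fun u _ =>
      (sum_le_sum_of_subset (filter_subset _ _)).trans (row_le_center u)
  rw [split]
  simp_rw [split, sum_add_distrib]
  rw [hm]
  rcases le_total (2 * #A) #B with h | h <;> nlinarith

lemma three_mul_sum_card_sq_le (hE : Function.Injective E) (hcard : ∀ u, #(E u) = 2)
    (head : V → α) :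
    3 * ∑ a, #{u | head u = a ∧ a ∈ E u} ^ 2 ≤ Fintype.card α ^ 3 := by
  let r : α → α → Prop := fun a b => a ≠ b ∧ ∃ u, E u = {a, b} ∧ head u = a
  let x : α → α → ℕ := fun a b => if r a b then 1 else 0
  have hr : ∀ a b, r a b → ¬ r b a := by
    rintro a b ⟨hab, u, hu, rfl⟩ ⟨-, v, hv, rfl⟩
    rw [pair_comm, ← hu] at hv
    exact hab (congrArg head (hE hv)).symm
  have hdeg : ∀ a, #{u | head u = a ∧ a ∈ E u} ≤ ∑ b, x a b := by
    intro a
    rw [← card_filter, ← card_image_of_injective _ hE]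
    refine (card_le_card (t := image (fun b => {a, b}) {b | r a b}) ?_).trans card_image_le
    intro e he
    obtain ⟨u, hu, rfl⟩ := mem_image.1 he
    obtain ⟨hu, ha⟩ := (mem_filter.1 hu).2
    obtain ⟨p, q, hpq, h⟩ := card_eq_two.1 (hcard u)
    rw [h] at ha
    rcases mem_insert.1 ha with rfl | ha
    · exact mem_image.2 ⟨q, by simpa using ⟨hpq, u, h, hu⟩, h.symm⟩
    · obtain rfl := mem_singleton.1 ha
      rw [pair_comm] at h
      exact mem_image.2 ⟨p, by simpa using ⟨hpq.symm, u, h, hu⟩, h.symm⟩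
  have htri : ∀ a b c, x a b * x a c + x b c * x b a + x c a * x c b ≤ 1 := by
    intro a b c
    have h₁ := hr a b
    have h₂ := hr b c
    have h₃ := hr c a
    by_cases r a b <;> by_cases r b a <;> by_cases r b c <;> by_cases r c b <;>
      by_cases r a c <;> by_cases r c a <;> simp_all [x]
  have hsum : ∑ a, ∑ b, ∑ c, (x a b * x a c + x b c * x b a + x c a * x c b) ≤
      Fintype.card α ^ 3 := by
    calc _ ≤ ∑ a : α, ∑ b : α, ∑ c : α, 1 :=
          sum_le_sum fun a _ => sum_le_sum fun b _ => sum_le_sum fun c _ => htri a b c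
      _ = _ := by simp [pow_succ, mul_assoc]
  have h₁ : ∑ a, ∑ b, ∑ c, x a b * x a c = ∑ a, (∑ b, x a b) ^ 2 := by
    simp_rw [sq, sum_mul_sum]
  have h₂ : ∑ a, ∑ b, ∑ c, x b c * x b a = ∑ a, (∑ b, x a b) ^ 2 := by
    rw [sum_comm]
    simp_rw [sq, sum_mul_sum]
    exact sum_congr rfl fun _ _ => sum_comm
  have h₃ : ∑ a, ∑ b, ∑ c, x c a * x c b = ∑ a, (∑ b, x a b) ^ 2 := by
    rw [← h₁]
    simp_rw [sum_comm (s := univ) (t := univ) (f := fun b c => x c _ * x c b)]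
    rw [sum_comm]
  simp_rw [sum_add_distrib, h₁, h₂, h₃] at hsum
  have hle : ∑ a, #{u | head u = a ∧ a ∈ E u} ^ 2 ≤ ∑ a, (∑ b, x a b) ^ 2 :=
    sum_le_sum fun a _ => Nat.pow_le_pow_left (hdeg a) 2
  omega

lemma sum_eq_sum_parts {M : Type*} [AddCommMonoid M] (P : Finpartition (univ : Finset V))
    (f : V → M) : ∑ u, f u = ∑ t ∈ P.parts, ∑ u ∈ t, f u := by
  conv_lhs => rw [← P.biUnion_parts]
  exact sum_biUnion P.disjoint

lemma samePart_iff_mem {P : Finpartition (univ : Finset V)} {t : Finset V} (ht : t ∈ P.parts)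
    {u : V} (hu : u ∈ t) (v : V) : SamePart P u v ↔ v ∈ t := by
  constructor
  · rintro ⟨s, hs, hus, hvs⟩
    rwa [P.eq_of_mem_parts ht hs hu hus]
  · exact fun hv => ⟨t, ht, hu, hv⟩

lemma three_mul_sum_parts_sq_le (hE : Function.Injective E) (hcard : ∀ u, #(E u) = 2)
    (P : Finpartition (univ : Finset V)) (c : Finset V → α) :
    3 * ∑ t ∈ P.parts, #{u ∈ t | c t ∈ E u} ^ 2 ≤ Fintype.card α ^ 3 := by
  refine le_trans (Nat.mul_le_mul_left 3 ?_)
    (three_mul_sum_card_sq_le hE hcard fun u => c (P.part u))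
  rw [← sum_fiberwise P.parts c]
  refine sum_le_sum fun a _ => ?_
  have h : #{u | c (P.part u) = a ∧ a ∈ E u} =
      ∑ t ∈ P.parts with c t = a, #{u ∈ t | c t ∈ E u} := by
    rw [card_filter, sum_eq_sum_parts P, sum_filter]
    refine sum_congr rfl fun t ht => ?_
    split_ifs with hc
    · rw [card_filter]
      refine sum_congr rfl fun u hu => ?_
      simp [P.part_eq_of_mem ht hu, hc]
    · refine sum_eq_zero fun u hu => ?_
      simp [P.part_eq_of_mem ht hu, hc]
  rw [h]
  exact sum_sq_le_sq_sum_of_nonneg fun _ _ => Nat.zero_le _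

lemma degree_eq (hE : Function.Injective E) (hrange : ∀ s, #s = 2 ↔ ∃ u, E u = s) (a : α) :
    #{u | a ∈ E u} + 1 = Fintype.card α := by
  have h : image E {u | a ∈ E u} = image (fun b => {a, b}) (univ.erase a) := by
    ext s
    simp only [mem_image, mem_filter, mem_univ, true_and, mem_erase, and_true]
    constructor
    · rintro ⟨u, ha, rfl⟩
      obtain ⟨p, q, hpq, h⟩ := card_eq_two.1 ((hrange _).2 ⟨u, rfl⟩)
      rw [h] at ha ⊢
      rcases mem_insert.1 ha with rfl | ha
      · exact ⟨q, hpq.symm, rfl⟩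
      · obtain rfl := mem_singleton.1 ha
        exact ⟨p, hpq, pair_comm _ _⟩
    · rintro ⟨b, hb, rfl⟩
      obtain ⟨u, hu⟩ := (hrange {a, b}).1 (card_pair hb.symm)
      exact ⟨u, by simp [hu], hu⟩
  rw [← card_image_of_injective _ hE, h, card_image_of_injOn, card_erase_add_one (mem_univ a),
    card_univ]
  intro b hb b' _ hbb
  have : b ∈ ({a, b'} : Finset α) := by
    rw [← show ({a, b} : Finset α) = {a, b'} from hbb]; simp
  simpa [(mem_erase.1 hb).1] using this



lemma mul_sum_card_inter_eq (hE : Function.Injective E)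
    (hrange : ∀ s, #s = 2 ↔ ∃ u, E u = s) {k : ℕ} (hk : Fintype.card α = k + 1) :
    ∑ u, ∑ v, #(E u ∩ E v) = (k + 1) * k ^ 2 ∧ 2 * Fintype.card V = (k + 1) * k := by
  have hdeg : ∀ a, #{u | a ∈ E u} = k := fun a => by
    have := degree_eq hE hrange a
    omega
  constructor
  · rw [sum_sum_card_inter]
    simp [hdeg, hk, sq]
  · have hcard : ∀ u, #(E u) = 2 := fun u => (hrange _).2 ⟨u, rfl⟩
    have h : ∑ u, #(E u) = ∑ a, #{u | a ∈ E u} := by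
      simp_rw [card_filter]
      rw [sum_comm]
      exact sum_congr rfl fun u _ => by rw [← card_filter, filter_univ_mem]
    simp only [hcard, hdeg, sum_const, card_univ, hk, smul_eq_mul] at h
    omega

/-- Two elements are joined by a `+`pair when their images under `E` meet. -/
def meetPairs (E : V → Finset α) (u v : V) : Bool :=
  decide (E u ∩ E v).Nonempty

/-- The fractional clustering that gives weight `1/2` to each star `{u | a ∈ E u}`. -/
noncomputable def starWeight (E : V → Finset α) (S : Finset V) : ℝ :=
  ∑ a, if ({u | a ∈ E u} : Finset V) = S then 1 / 2 else 0

lemma sum_starWeight (p : Finset V → Prop) [DecidablePred p] :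
    ∑ S with p S, starWeight E S = #{a | p {u | a ∈ E u}} / 2 := by
  simp_rw [starWeight]
  rw [sum_comm, card_filter, Nat.cast_sum, sum_div]
  refine sum_congr rfl fun a _ => ?_
  rw [sum_ite_eq]
  simp [ite_div]

lemma isClusterLP_starWeight (hcard : ∀ u, #(E u) = 2) : IsClusterLP (starWeight E) := by
  refine ⟨fun S _ => sum_nonneg fun a _ => by split_ifs <;> norm_num, fun u => ?_⟩
  rw [sum_starWeight]
  simp [hcard]

lemma yPair_starWeight (u v : V) : yPair (starWeight E) u v = #(E u ∩ E v) / 2 := by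
  rw [yPair, sum_starWeight, ← filter_univ_mem (E u ∩ E v)]
  simp

lemma card_inter_of_ne (hE : Function.Injective E) (hcard : ∀ u, #(E u) = 2) {u v : V}
    (h : u ≠ v) : #(E u ∩ E v) = if meetPairs E u v then 1 else 0 := by
  have := card_inter_le hE hcard u v
  rw [if_neg h] at this
  split_ifs with hp
  · have := card_pos.2 (of_decide_eq_true hp)
    omega
  · rw [card_eq_zero, ← not_nonempty_iff_eq_empty]
    simpa [meetPairs] using hp

lemma four_mul_objLP (hE : Function.Injective E) (hcard : ∀ u, #(E u) = 2) :
    4 * objLP (meetPairs E) (starWeight E) =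
      (∑ u, ∑ v, #(E u ∩ E v) : ℕ) - 2 * Fintype.card V := by
  have h : ∀ u v : V, (if u ≠ v then if meetPairs E u v = true then xPair (starWeight E) u v
      else 1 - xPair (starWeight E) u v else 0) =
      (#(E u ∩ E v) - if u = v then 2 else 0 : ℝ) / 2 := by
    intro u v
    by_cases huv : u = v
    · subst huv
      simp [hcard]
    · have := card_inter_of_ne hE hcard huv
      simp only [xPair, yPair_starWeight, this, huv, ne_eq, not_false_eq_true, if_true, if_false]
      split_ifs <;> norm_num
  rw [objLP, sum_filter, Fintype.sum_prod_type]
  simp_rw [h, ← sum_div, sum_sub_distrib]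
  simp
  ring

lemma two_mul_objClust (hE : Function.Injective E) (hcard : ∀ u, #(E u) = 2)
    (P : Finpartition (univ : Finset V)) :
    2 * objClust (meetPairs E) P = (∑ u, ∑ v, #(E u ∩ E v) : ℕ) + Fintype.card V +
      ∑ t ∈ P.parts, ((#t : ℝ) ^ 2 - 2 * (∑ u ∈ t, ∑ v ∈ t, #(E u ∩ E v) : ℕ)) := by
  have h : ∀ u v : V,
      ((if u ≠ v ∧ meetPairs E u v = true ∧ ¬ SamePart P u v then 1 else 0) +
        (if u ≠ v ∧ meetPairs E u v = false ∧ SamePart P u v then 1 else 0) : ℝ) =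
      #(E u ∩ E v) + (if u = v then 1 else 0) +
        if SamePart P u v then 1 - 2 * (#(E u ∩ E v) : ℝ) else 0 := by
    intro u v
    by_cases huv : u = v
    · subst huv
      have : SamePart P u u := ⟨P.part u, by simp, by simp, by simp⟩
      simp [hcard, this]
      norm_num
    · have := card_inter_of_ne hE hcard huv
      by_cases hs : SamePart P u v <;> by_cases hp : meetPairs E u v = true <;>
        simp [this, huv, hs, hp]
      norm_num
  have hparts : ∑ u, ∑ v, (if SamePart P u v then 1 - 2 * (#(E u ∩ E v) : ℝ) else 0) =
      ∑ t ∈ P.parts, ((#t : ℝ) ^ 2 - 2 * (∑ u ∈ t, ∑ v ∈ t, #(E u ∩ E v) : ℕ)) := by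
    rw [sum_eq_sum_parts P]
    refine sum_congr rfl fun t ht => ?_
    have : ∀ u ∈ t, ∑ v, (if SamePart P u v then 1 - 2 * (#(E u ∩ E v) : ℝ) else 0) =
        ∑ v ∈ t, (1 - 2 * (#(E u ∩ E v) : ℝ)) := fun u hu => by
      simp_rw [samePart_iff_mem ht hu]
      simp
    rw [sum_congr rfl this]
    simp_rw [sum_sub_distrib, ← mul_sum]
    simp [sq]
  rw [objClust, ← hparts, ← sum_boole, ← sum_boole, ← sum_add_distrib, Fintype.sum_prod_type]
  simp_rw [h, sum_add_distrib]
  simp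
  ring

lemma le_two_mul_objClust [Nonempty α] (hE : Function.Injective E) (hcard : ∀ u, #(E u) = 2)
    (P : Finpartition (univ : Finset V)) :
    ((∑ u, ∑ v, #(E u ∩ E v) : ℕ) : ℝ) - 9 * Fintype.card V - (Fintype.card α : ℝ) ^ 3 / 3 ≤
      2 * objClust (meetPairs E) P := by
  choose c hc using exists_center (E := E) hE hcard
  have h₁ := three_mul_sum_parts_sq_le hE hcard P c
  have h₂ : -∑ t ∈ P.parts, ((#{u ∈ t | c t ∈ E u} : ℝ) ^ 2 + 10 * #t) ≤
      ∑ t ∈ P.parts, ((#t : ℝ) ^ 2 - 2 * (∑ u ∈ t, ∑ v ∈ t, #(E u ∩ E v) : ℕ)) := by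
    rw [← sum_neg_distrib]
    refine sum_le_sum fun t _ => ?_
    have : (2 * (∑ u ∈ t, ∑ v ∈ t, #(E u ∩ E v) : ℕ) : ℝ) ≤
        #t ^ 2 + #{u ∈ t | c t ∈ E u} ^ 2 + 10 * #t := mod_cast hc t
    linarith
  have h₃ : ∑ t ∈ P.parts, (#t : ℝ) = Fintype.card V := mod_cast P.sum_card_parts
  have h₄ : 3 * ∑ t ∈ P.parts, (#{u ∈ t | c t ∈ E u} : ℝ) ^ 2 ≤ Fintype.card α ^ 3 :=
    mod_cast h₁
  rw [sum_add_distrib, ← mul_sum, h₃] at h₂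
  rw [two_mul_objClust hE hcard P]
  linarith

end EdgeClusters

lemma exists_enumeration_pairs (α : Type*) [Fintype α] [DecidableEq α] :
    ∃ (n : ℕ) (E : Fin n → Finset α), Function.Injective E ∧ ∀ s, #s = 2 ↔ ∃ u, E u = s := by
  let e := Fintype.equivFin {s : Finset α // #s = 2}
  refine ⟨_, fun u => (e.symm u).1, Subtype.val_injective.comp e.symm.injective, fun s => ?_⟩
  exact ⟨fun h => ⟨e ⟨s, h⟩, by simp⟩, fun ⟨u, hu⟩ => hu ▸ (e.symm u).2⟩

/-- The integrality gap of the cluster LP is at least `4/3 - ε`. -/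
theorem cluster_LP_integrality_gap (ε : ℝ) (hε : 0 < ε) :
    ∃ n : ℕ, 0 < n ∧
      ∃ plus : Fin n → Fin n → Bool, (∀ a b : Fin n, plus a b = plus b a) ∧
        ∃ z : Finset (Fin n) → ℝ, IsClusterLP z ∧
          0 < objLP plus z ∧
          ∀ P : Finpartition (univ : Finset (Fin n)),
            (4 / 3 - ε) * objLP plus z ≤ objClust plus P := by
  obtain ⟨m, hm⟩ := exists_nat_gt (11 / ε)
  set k := m + 2 with hk
  obtain ⟨n, E, hE, hrange⟩ := exists_enumeration_pairs (Fin (k + 1))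
  have hcard : ∀ u, #(E u) = 2 := fun u => (hrange _).2 ⟨u, rfl⟩
  obtain ⟨hsum, hn⟩ := mul_sum_card_inter_eq hE hrange (Fintype.card_fin (k + 1))
  have hLP := four_mul_objLP hE hcard
  rw [Fintype.card_fin] at hn
  have hn' : (2 * n : ℝ) = (k + 1) * k := mod_cast hn
  have hkm : (k : ℝ) = m + 2 := by simp [hk]
  rw [hsum, Fintype.card_fin, hn'] at hLP
  push_cast at hLP
  rw [hkm] at hLP hn'
  have hm0 : (0 : ℝ) ≤ m := m.cast_nonneg
  refine ⟨n, Nat.pos_of_ne_zero (by rintro rfl; simp [hk] at hn), meetPairs E, fun a b => by simp [meetPairs, inter_comm],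
    starWeight E, isClusterLP_starWeight hcard, by nlinarith, fun P => ?_⟩
  have hP := le_two_mul_objClust hE hcard P
  rw [hsum, Fintype.card_fin, Fintype.card_fin] at hP
  push_cast at hP
  rw [hkm] at hP
  rw [div_lt_iff₀ hε] at hm
  have hmε : 0 ≤ ((m : ℝ) + 3) * (m + 2) * (m * ε - 11) := by
    have : 0 ≤ m * ε - 11 := by linarith
    positivity
  nlinarith [mul_nonneg hm0 hm0, mul_nonneg (mul_nonneg hm0 hm0) hε.le]
end

section
/- Let n ≥ 1 and consider the complete graph K_n on vertex set {1, …, n}. Suppose the edge set of K_n is partitioned into sets C_1, …, C_t such that for each i all edges of C_i are incident to a common vertex v_i, where v_1, …, v_t are pairwise distinct vertices. Then the sum over i of |C_i|² is at most n³/3. -/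
open Finset

/-- The squared out-degrees of an asymmetric relation on `α` sum to at most `|α| ^ 3 / 3`: a triple
in which one fixed entry dominates the other two never keeps this property when rotated. -/
theorem three_mul_sum_card_sq_le_of_asymm {α : Type*} [Fintype α] (r : α → α → Prop)
    [DecidableRel r] (hr : ∀ x y, r x y → ¬ r y x) :
    3 * ∑ x, #{y | r x y} ^ 2 ≤ Fintype.card α ^ 3 := by
  let f : α → α → ℕ := fun x y => if r x y then 1 else 0
  have h₁ : ∑ x, #{y | r x y} ^ 2 = ∑ x, ∑ y, ∑ z, f x y * f x z := by
    refine sum_congr rfl fun x _ => ?_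
    rw [card_filter, sq, sum_mul_sum]
  have h₂ : ∑ x, ∑ y, ∑ z, f x y * f x z = ∑ x, ∑ y, ∑ z, f y z * f y x := by
    rw [sum_comm]
    refine sum_congr rfl fun x _ => sum_congr rfl fun y _ => sum_congr rfl fun z _ => ?_
    ring
  have h₃ : ∑ x, ∑ y, ∑ z, f x y * f x z = ∑ x, ∑ y, ∑ z, f z x * f z y := by
    rw [sum_comm]
    refine sum_congr rfl fun x _ => ?_
    rw [sum_comm]
  have hf (x y : α) : f x y = 0 ∧ f y x ≤ 1 ∨ f x y = 1 ∧ f y x = 0 := by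
    by_cases h : r x y
    · simp [f, h, hr x y h]
    · by_cases h' : r y x <;> simp [f, h, h']
  have h₄ (x y z : α) : f x y * f x z + f y z * f y x + f z x * f z y ≤ 1 := by
    obtain ⟨hxy, hyx⟩ | ⟨hxy, hyx⟩ := hf x y <;>
    obtain ⟨hyz, hzy⟩ | ⟨hyz, hzy⟩ := hf y z <;>
    obtain ⟨hzx, hxz⟩ | ⟨hzx, hxz⟩ := hf z x <;>
    simp [*]
  calc 3 * ∑ x, #{y | r x y} ^ 2
      = ∑ x, ∑ y, ∑ z, (f x y * f x z + f y z * f y x + f z x * f z y) := by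
        simp only [sum_add_distrib]
        rw [← h₂, ← h₃, h₁]
        ring
    _ ≤ ∑ _x : α, ∑ _y : α, ∑ _z : α, 1 := by
        gcongr with x _ y _ z _
        exact h₄ x y z
    _ = Fintype.card α ^ 3 := by
        simp only [sum_const, card_univ, smul_eq_mul]
        ring

theorem star_partition_sum_sq_le
    (n t : ℕ) (hn : 1 ≤ n)
    (C : Fin t → Finset (Sym2 (Fin n))) (v : Fin t → Fin n)
    (hinj : Function.Injective v)
    (hdisj : ∀ i j : Fin t, i ≠ j → Disjoint (C i) (C j))
    (hcover : Finset.univ.biUnion C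
        = univ.filter (fun e : Sym2 (Fin n) => ¬ e.IsDiag))
    (hstar : ∀ i : Fin t, ∀ e ∈ C i, v i ∈ e) :
    (∑ i : Fin t, ((C i).card : ℝ) ^ 2) ≤ (n : ℝ) ^ 3 / 3 := by
  classical
  let r : Fin n → Fin n → Prop := fun x y => ∃ i, v i = x ∧ s(x, y) ∈ C i
  have hr : ∀ x y, r x y → ¬ r y x := by
    rintro _ _ ⟨i, rfl, hi⟩ ⟨j, rfl, hj⟩
    rw [Sym2.eq_swap] at hj
    obtain rfl : i = j := by
      by_contra hij
      exact disjoint_left.mp (hdisj i j hij) hi hj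
    have hmem := mem_biUnion.mpr ⟨i, mem_univ i, hi⟩
    rw [hcover] at hmem
    simp at hmem
  have hcard (i : Fin t) : #(C i) ≤ #{y | r (v i) y} := by
    refine (card_le_card fun e he => ?_).trans
      (card_image_le (s := {y | r (v i) y}) (f := fun y => s(v i, y)))
    obtain ⟨y, rfl⟩ := hstar i e he
    exact mem_image.mpr ⟨y, by simpa using ⟨i, rfl, he⟩, rfl⟩
  have hsum : ∑ i, #(C i) ^ 2 ≤ ∑ x, #{y | r x y} ^ 2 :=
    calc ∑ i, #(C i) ^ 2
        ≤ ∑ i, #{y | r (v i) y} ^ 2 := sum_le_sum fun i _ => Nat.pow_le_pow_left (hcard i) 2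
      _ = ∑ x ∈ univ.image v, #{y | r x y} ^ 2 := by rw [sum_image hinj.injOn]
      _ ≤ ∑ x, #{y | r x y} ^ 2 := sum_le_sum_of_subset (subset_univ _)
  have hbound : 3 * ∑ i, #(C i) ^ 2 ≤ n ^ 3 := by
    simpa using (Nat.mul_le_mul_left 3 hsum).trans (three_mul_sum_card_sq_le_of_asymm r hr)
  have hreal : 3 * ∑ i, (#(C i) : ℝ) ^ 2 ≤ (n : ℝ) ^ 3 := by exact_mod_cast hbound
  linarith
end

section
/- Consider the correlation clustering instance on V = {0,1,2,3,4} in which the +pairs are exactly the pairs {0,i} for i = 1,2,3,4 and all other pairs are -pairs. Then: (i) every partition of V has cost at least 3; (ii) the vectors v_1, v_2, v_3, v_4 ∈ ℝ⁴ given by the standard basis vectors together with v_0 := (1/2, 1/2, 1/2, 1/2) are unit vectors with v_i · v_j ≥ 0 for all i, j ∈ V, the values x_{ij} := 1 − v_i · v_j satisfy the triangle inequalities x_{ij} ≤ x_{ik} + x_{jk} for all i, j, k ∈ V, and the SDP objective (sum over +pairs ij of x_{ij}) + (sum over -pairs ij of (1 − x_{ij})) equals 2. Consequently, the integrality gap of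 the standard SDP relaxation of correlation clustering on this instance, namely the ratio of the minimum clustering cost to the SDP objective, is at least 3/2. -/
open Finset
open scoped Classical

variable {V : Type*} [Fintype V] [DecidableEq V]

/-- The star instance on `{0,1,2,3,4}`: the `+`pairs are exactly the pairs `{0,i}`, `i ≠ 0`. -/
def plusStar : Fin 5 → Fin 5 → Bool := fun a b =>
  (a == 0 && b != 0) || (b == 0 && a != 0)

/-- The SDP vectors: the four standard basis vectors of `ℝ⁴` for the leaves `1,2,3,4`,
and `(1/2,1/2,1/2,1/2)` for the center `0`. -/
noncomputable def vecStar : Fin 5 → Fin 4 → ℝ :=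
  ![![1/2, 1/2, 1/2, 1/2], ![1, 0, 0, 0], ![0, 1, 0, 0], ![0, 0, 1, 0], ![0, 0, 0, 1]]

/-- `x_{ij} := 1 - v_i · v_j`. -/
noncomputable def xSDP (i j : Fin 5) : ℝ :=
  1 - ∑ k : Fin 4, vecStar i k * vecStar j k

/-- The SDP objective: sum over `+`pairs of `x_{ij}` plus sum over `-`pairs of `1 - x_{ij}`
(each unordered pair counted once, via ordered pairs divided by two). -/
noncomputable def sdpObjStar : ℝ :=
  (∑ p ∈ (univ : Finset (Fin 5 × Fin 5)).filter (fun p => p.1 ≠ p.2),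
      if plusStar p.1 p.2 = true then xSDP p.1 p.2 else 1 - xSDP p.1 p.2) / 2

theorem SamePart.symm {P : Finpartition (univ : Finset V)} {u v : V} (h : SamePart P u v) :
    SamePart P v u :=
  let ⟨t, ht, hu, hv⟩ := h
  ⟨t, ht, hv, hu⟩

theorem samePart_comm {P : Finpartition (univ : Finset V)} {u v : V} :
    SamePart P u v ↔ SamePart P v u :=
  ⟨SamePart.symm, SamePart.symm⟩

theorem SamePart.trans {P : Finpartition (univ : Finset V)} {u v w : V} (huv : SamePart P u v)
    (hvw : SamePart P v w) : SamePart P u w := by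
  obtain ⟨t, ht, hu, hv⟩ := huv
  obtain ⟨s, hs, hv', hw⟩ := hvw
  obtain rfl := P.eq_of_mem_parts ht hs hv hv'
  exact ⟨t, ht, hu, hw⟩

/-- The cost of a clustering of the star, as a sum of indicators over unordered pairs. -/
theorem objClust_plusStar (P : Finpartition (univ : Finset (Fin 5))) :
    objClust plusStar P =
      ((if SamePart P 0 1 then 0 else 1) + (if SamePart P 0 2 then 0 else 1) +
        (if SamePart P 0 3 then 0 else 1) + (if SamePart P 0 4 then 0 else 1)) +
      ((if SamePart P 1 2 then 1 else 0) + (if SamePart P 1 3 then 1 else 0) +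
        (if SamePart P 1 4 then 1 else 0) + (if SamePart P 2 3 then 1 else 0) +
        (if SamePart P 2 4 then 1 else 0) + (if SamePart P 3 4 then 1 else 0)) := by
  unfold objClust
  simp only [card_filter, Fintype.sum_prod_type, Fin.sum_univ_five]
  simp [plusStar, ite_not, samePart_comm (u := (1 : Fin 5)) (v := 0),
    samePart_comm (u := (2 : Fin 5)) (v := 0), samePart_comm (u := (3 : Fin 5)) (v := 0),
    samePart_comm (u := (4 : Fin 5)) (v := 0), samePart_comm (u := (2 : Fin 5)) (v := 1),
    samePart_comm (u := (3 : Fin 5)) (v := 1), samePart_comm (u := (4 : Fin 5)) (v := 1),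
    samePart_comm (u := (3 : Fin 5)) (v := 2), samePart_comm (u := (4 : Fin 5)) (v := 2),
    samePart_comm (u := (4 : Fin 5)) (v := 3)]
  ring

theorem three_le_objClust_plusStar (P : Finpartition (univ : Finset (Fin 5))) :
    (3 : ℝ) ≤ objClust plusStar P := by
  have joined (i j : Fin 5) (hi : SamePart P 0 i) (hj : SamePart P 0 j) : SamePart P i j :=
    hi.symm.trans hj
  have nonneg (i j : Fin 5) : (0 : ℝ) ≤ if SamePart P i j then 1 else 0 := by
    split_ifs <;> norm_num
  have n12 := nonneg 1 2
  have n13 := nonneg 1 3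
  have n14 := nonneg 1 4
  have n23 := nonneg 2 3
  have n24 := nonneg 2 4
  have n34 := nonneg 3 4
  rw [objClust_plusStar]
  by_cases h1 : SamePart P 0 1 <;> by_cases h2 : SamePart P 0 2 <;>
    by_cases h3 : SamePart P 0 3 <;> by_cases h4 : SamePart P 0 4 <;>
    simp only [h1, h2, h3, h4, joined, if_true, if_false] at * <;> linarith

theorem xSDP_eq (i j : Fin 5) :
    xSDP i j = if i = j then 0 else if i = 0 ∨ j = 0 then 1 / 2 else 1 := by
  fin_cases i <;> fin_cases j <;> norm_num [xSDP, vecStar, Fin.sum_univ_succ, Fin.ext_iff]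

theorem sdpObjStar_eq : sdpObjStar = 2 := by
  unfold sdpObjStar
  simp only [sum_filter, Fintype.sum_prod_type, Fin.sum_univ_five, xSDP_eq]
  norm_num [plusStar, Fin.ext_iff]

theorem sdp_integrality_gap_three_halves :
    (∀ P : Finpartition (univ : Finset (Fin 5)), (3 : ℝ) ≤ objClust plusStar P) ∧
    (∀ i : Fin 5, ∑ k : Fin 4, vecStar i k * vecStar i k = 1) ∧
    (∀ i j : Fin 5, 0 ≤ ∑ k : Fin 4, vecStar i k * vecStar j k) ∧
    (∀ i j k : Fin 5, xSDP i j ≤ xSDP i k + xSDP j k) ∧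
    sdpObjStar = 2 ∧
    (∀ P : Finpartition (univ : Finset (Fin 5)),
        (3 : ℝ) / 2 ≤ objClust plusStar P / sdpObjStar) := by
  refine ⟨three_le_objClust_plusStar, fun i => ?_, fun i j => ?_, fun i j k => ?_,
    sdpObjStar_eq, fun P => ?_⟩
  · fin_cases i <;> norm_num [vecStar, Fin.sum_univ_succ]
  · fin_cases i <;> fin_cases j <;> norm_num [vecStar, Fin.sum_univ_succ]
  · simp only [xSDP_eq]
    split_ifs <;> grind
  · rw [sdpObjStar_eq]
    linarith [three_le_objClust_plusStar P]
end

section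
/- Let (V, E^+, E^-) be a correlation clustering instance on a finite set V, and for u ∈ V let N^+_u := {u} ∪ {v : uv is a +pair}. Let β = 0.1 and let K ⊆ V with |K| ≥ 2 be such that for every u ∈ K the symmetric difference N^+_u △ K has size strictly less than β·|K|. Then in every partition 𝒞 of V that minimizes obj(𝒞) over all partitions of V, the set K is entirely contained in a single part of 𝒞. -/
open Finset
open scoped Classical symmDiff

variable {V : Type*} [Fintype V] [DecidableEq V]

/-- `N^+_u := {u} ∪ {v : uv is a +pair}`. -/
def NPlus (plus : V → V → Bool) (u : V) : Finset V :=
  insert u (univ.filter (fun v => v ≠ u ∧ plus u v = true))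

/-- The signed weight of a pair: `1` on `+`pairs, `-1` on `-`pairs, `0` on the diagonal. -/
noncomputable def pairSign (plus : V → V → Bool) (a b : V) : ℝ :=
  if a = b then 0 else if plus a b = true then 1 else -1

/-- The indicator of lying in the same part of `P`. -/
noncomputable def sameInd (P : Finpartition (univ : Finset V)) (a b : V) : ℝ :=
  if SamePart P a b then 1 else 0

/-- The indicator of `b ∈ N^+_u`. -/
noncomputable def nbrInd (plus : V → V → Bool) (u b : V) : ℝ :=
  if b ∈ NPlus plus u then 1 else 0

lemma samePart_iff_part_eq (P : Finpartition (univ : Finset V)) (a b : V) :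
    SamePart P a b ↔ P.part a = P.part b := by
  constructor
  · rintro ⟨t, ht, ha, hb⟩
    rw [P.part_eq_of_mem ht ha, P.part_eq_of_mem ht hb]
  · intro h
    exact ⟨P.part a, P.part_mem.2 (mem_univ a), P.mem_part (mem_univ a),
      h ▸ P.mem_part (mem_univ b)⟩

lemma samePart_ofSetoid_iff (r : Setoid V) (a b : V) :
    SamePart (Finpartition.ofSetoid r) a b ↔ r a b := by
  rw [samePart_iff_part_eq, ← Finpartition.mem_part_iff_part_eq_part _ (mem_univ _) (mem_univ _),
    Finpartition.mem_part_ofSetoid_iff_rel]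
  exact ⟨fun h => r.symm h, fun h => r.symm h⟩

/-- The relation obtained from `P` by making `S` a part of its own. -/
def carveSetoid (P : Finpartition (univ : Finset V)) (S : Finset V) : Setoid V where
  r a b := (a ∈ S ∧ b ∈ S) ∨ (a ∉ S ∧ b ∉ S ∧ P.part a = P.part b)
  iseqv :=
    { refl := fun a => by by_cases h : a ∈ S <;> simp [h]
      symm := by
        rintro a b (h | h)
        · exact Or.inl ⟨h.2, h.1⟩
        · exact Or.inr ⟨h.2.1, h.1, h.2.2.symm⟩
      trans := by
        rintro a b c (h | h) (h' | h')
        · exact Or.inl ⟨h.1, h'.2⟩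
        · exact absurd h.2 h'.1
        · exact absurd h'.1 h.2.1
        · exact Or.inr ⟨h.1, h'.2.1, h.2.2.trans h'.2.2⟩ }

lemma two_mul_objClust_s15 (plus : V → V → Bool) (P : Finpartition (univ : Finset V)) :
    2 * objClust plus P =
      (∑ a, ∑ b, if a ≠ b ∧ plus a b = true then (1 : ℝ) else 0) -
        ∑ a, ∑ b, pairSign plus a b * sameInd P a b := by
  unfold objClust
  rw [mul_div_cancel₀ _ (two_ne_zero), card_filter, card_filter]
  push_cast
  rw [← Finset.sum_add_distrib, ← Finset.sum_sub_distrib, Fintype.sum_prod_type]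
  refine sum_congr rfl fun a _ => ?_
  rw [← Finset.sum_sub_distrib]
  refine sum_congr rfl fun b _ => ?_
  unfold pairSign sameInd
  by_cases hab : a = b <;> by_cases hp : plus a b = true <;> by_cases hs : SamePart P a b <;>
    simp [hab, hp, hs]

lemma pairSign_comm (plus : V → V → Bool) (hsym : ∀ a b : V, plus a b = plus b a) (a b : V) :
    pairSign plus a b = pairSign plus b a := by
  simp only [pairSign, hsym a b, eq_comm (a := a)]

lemma sameInd_comm (P : Finpartition (univ : Finset V)) (a b : V) :
    sameInd P a b = sameInd P b a := by
  simp only [sameInd, samePart_iff_part_eq, eq_comm (a := P.part a)]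

lemma sum_univ_split (S : Finset V) (f : V → V → ℝ) :
    ∑ a, ∑ b, f a b = (∑ a ∈ S, ∑ b ∈ S, f a b + ∑ a ∈ S, ∑ b ∈ Sᶜ, f a b) +
      (∑ a ∈ S, ∑ b ∈ Sᶜ, f b a + ∑ a ∈ Sᶜ, ∑ b ∈ Sᶜ, f a b) := by
  rw [sum_comm (s := S) (t := Sᶜ) (f := fun a b => f b a), ← sum_add_distrib, ← sum_add_distrib,
    ← sum_add_sum_compl S]
  simp only [sum_add_sum_compl]

/-- Making `S` a part of its own does not improve an optimal clustering. -/
lemma carve_le (plus : V → V → Bool) (hsym : ∀ a b : V, plus a b = plus b a)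
    (P : Finpartition (univ : Finset V))
    (hmin : ∀ Q : Finpartition (univ : Finset V), objClust plus P ≤ objClust plus Q)
    (S : Finset V) :
    ∑ a ∈ S, ∑ b ∈ S, pairSign plus a b * (1 - sameInd P a b) ≤
      2 * ∑ a ∈ S, ∑ b ∈ Sᶜ, pairSign plus a b * sameInd P a b := by
  set Q := Finpartition.ofSetoid (carveSetoid P S)
  have hQ : ∀ a b, sameInd Q a b =
      if (a ∈ S ∧ b ∈ S) ∨ (a ∉ S ∧ b ∉ S ∧ P.part a = P.part b) then 1 else 0 := by
    intro a b
    unfold sameInd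
    exact if_congr (samePart_ofSetoid_iff _ a b) rfl rfl
  have h := hmin Q
  have h1 := two_mul_objClust_s15 plus P
  have h2 := two_mul_objClust_s15 plus Q
  rw [sum_univ_split S (fun a b => pairSign plus a b * sameInd P a b)] at h1
  rw [sum_univ_split S (fun a b => pairSign plus a b * sameInd Q a b)] at h2
  have e1 : ∑ a ∈ S, ∑ b ∈ S, pairSign plus a b * sameInd Q a b =
      ∑ a ∈ S, ∑ b ∈ S, pairSign plus a b :=
    sum_congr rfl fun a ha => sum_congr rfl fun b hb => by simp [hQ, ha, hb]
  have e2 : ∑ a ∈ S, ∑ b ∈ Sᶜ, pairSign plus a b * sameInd Q a b = 0 :=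
    sum_eq_zero fun a ha => sum_eq_zero fun b hb => by
      simp [hQ, ha, mem_compl.1 hb]
  have e3 : ∑ a ∈ S, ∑ b ∈ Sᶜ, pairSign plus b a * sameInd Q b a = 0 :=
    sum_eq_zero fun a ha => sum_eq_zero fun b hb => by
      simp [hQ, ha, mem_compl.1 hb]
  have e4 : ∑ a ∈ Sᶜ, ∑ b ∈ Sᶜ, pairSign plus a b * sameInd Q a b =
      ∑ a ∈ Sᶜ, ∑ b ∈ Sᶜ, pairSign plus a b * sameInd P a b :=
    sum_congr rfl fun a ha => sum_congr rfl fun b hb => by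
      rw [hQ]
      simp [sameInd, samePart_iff_part_eq, mem_compl.1 ha, mem_compl.1 hb]
  have e5 : ∑ a ∈ S, ∑ b ∈ Sᶜ, pairSign plus b a * sameInd P b a =
      ∑ a ∈ S, ∑ b ∈ Sᶜ, pairSign plus a b * sameInd P a b :=
    sum_congr rfl fun a _ => sum_congr rfl fun b _ => by
      rw [pairSign_comm plus hsym, sameInd_comm]
  have e6 : ∑ a ∈ S, ∑ b ∈ S, pairSign plus a b * (1 - sameInd P a b) =
      ∑ a ∈ S, ∑ b ∈ S, pairSign plus a b -
        ∑ a ∈ S, ∑ b ∈ S, pairSign plus a b * sameInd P a b := by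
    simp only [mul_sub, mul_one, sum_sub_distrib]
  linarith

/-- Moving a single vertex `u` to the part of `a` does not improve an optimal clustering. -/
lemma move_le (plus : V → V → Bool) (hsym : ∀ a b : V, plus a b = plus b a)
    (P : Finpartition (univ : Finset V))
    (hmin : ∀ Q : Finpartition (univ : Finset V), objClust plus P ≤ objClust plus Q)
    (a u : V) (hu : ¬ SamePart P a u) :
    ∑ b, pairSign plus u b * sameInd P a b ≤ ∑ b, pairSign plus u b * sameInd P u b := by
  rw [samePart_iff_part_eq] at hu
  set C := univ.filter fun b => P.part a = P.part b with hC
  have hmem : ∀ b, b ∈ C ↔ P.part a = P.part b := by simp [hC]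
  have huC : u ∉ C := by simpa [hmem] using hu
  have h := carve_le plus hsym P hmin (insert u C)
  have hin : ∀ b ∈ C, sameInd P u b = 0 := by
    intro b hb
    rw [hmem] at hb
    simp only [sameInd, samePart_iff_part_eq, ← hb]
    exact if_neg fun h => hu h.symm
  have hCC : ∀ c ∈ C, ∀ b ∈ C, sameInd P c b = 1 := by
    intro c hc b hb
    rw [hmem] at hb hc
    simp [sameInd, samePart_iff_part_eq, ← hb, ← hc]
  have hout : ∀ c ∈ C, ∀ b ∈ (insert u C)ᶜ, sameInd P c b = 0 := by
    intro c hc b hb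
    have hb' : b ∉ C := fun h => mem_compl.1 hb (mem_insert_of_mem h)
    rw [hmem] at hb' hc
    simpa [sameInd, samePart_iff_part_eq, ← hc] using hb'
  have hs0 : pairSign plus u u = 0 := by simp [pairSign]
  have l1 : ∑ c ∈ C, ∑ b ∈ insert u C, pairSign plus c b * (1 - sameInd P c b) =
      ∑ b ∈ C, pairSign plus u b := by
    refine sum_congr rfl fun c hc => ?_
    rw [sum_insert huC, sum_eq_zero (s := C) fun b hb => by rw [hCC c hc b hb]; ring,
      sameInd_comm, hin c hc, pairSign_comm plus hsym]
    ring
  have l2 : ∑ b ∈ C, pairSign plus u b * (1 - sameInd P u b) = ∑ b ∈ C, pairSign plus u b :=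
    sum_congr rfl fun b hb => by rw [hin b hb]; ring
  have l3 : ∑ c ∈ C, ∑ b ∈ (insert u C)ᶜ, pairSign plus c b * sameInd P c b = 0 :=
    sum_eq_zero fun c hc => sum_eq_zero fun b hb => by rw [hout c hc b hb, mul_zero]
  rw [sum_insert huC, sum_insert huC, sum_insert huC, l1, l2, l3, hs0] at h
  have r1 : ∑ b, pairSign plus u b * sameInd P a b = ∑ b ∈ C, pairSign plus u b := by
    rw [hC, sum_filter]
    exact sum_congr rfl fun b _ => by simp [sameInd, samePart_iff_part_eq]
  have r2 : ∑ b, pairSign plus u b * sameInd P u b =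
      ∑ b ∈ (insert u C)ᶜ, pairSign plus u b * sameInd P u b := by
    rw [← sum_add_sum_compl (insert u C), sum_insert huC, hs0,
      sum_eq_zero (s := C) fun b hb => by rw [hin b hb, mul_zero]]
    ring
  linarith

lemma card_symmDiff_eq_sum (plus : V → V → Bool) (K : Finset V) (u : V) :
    (((NPlus plus u) ∆ K).card : ℝ) =
      ∑ b ∈ K, (1 - nbrInd plus u b) + ∑ b ∈ Kᶜ, nbrInd plus u b := by
  have h1 : (NPlus plus u) ∆ K = K.filter (· ∉ NPlus plus u) ∪ Kᶜ.filter (· ∈ NPlus plus u) := by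
    ext b
    simp only [mem_symmDiff, mem_union, mem_filter, mem_compl]
    tauto
  have h2 : Disjoint (K.filter (· ∉ NPlus plus u)) (Kᶜ.filter (· ∈ NPlus plus u)) :=
    disjoint_filter_filter disjoint_compl_right
  rw [h1, card_union_of_disjoint h2, card_filter, card_filter]
  push_cast
  congr 1
  refine sum_congr rfl fun b _ => ?_
  unfold nbrInd
  by_cases h : b ∈ NPlus plus u <;> simp [h]

lemma pairSign_le_one (plus : V → V → Bool) (u b : V) : pairSign plus u b ≤ 1 := by
  unfold pairSign
  split_ifs <;> norm_num

lemma neg_one_le_pairSign (plus : V → V → Bool) (u b : V) : -1 ≤ pairSign plus u b := by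
  unfold pairSign
  split_ifs <;> norm_num

lemma pairSign_eq_of_ne (plus : V → V → Bool) {u b : V} (h : b ≠ u) :
    pairSign plus u b = 2 * nbrInd plus u b - 1 := by
  unfold pairSign nbrInd NPlus
  by_cases hp : plus u b = true <;> simp [h, h.symm, hp]
  norm_num

lemma nbrInd_mem_Icc (plus : V → V → Bool) (u b : V) :
    nbrInd plus u b ∈ Set.Icc (0 : ℝ) 1 := by
  unfold nbrInd
  split_ifs <;> simp

lemma sameInd_mem_Icc (P : Finpartition (univ : Finset V)) (u b : V) :
    sameInd P u b ∈ Set.Icc (0 : ℝ) 1 := by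
  unfold sameInd
  split_ifs <;> simp

lemma sameInd_self (P : Finpartition (univ : Finset V)) (u : V) : sameInd P u u = 1 := by
  simp [sameInd, samePart_iff_part_eq]

/-- An atom, i.e. a set `K` in which every vertex has `+`neighborhood almost equal to `K`,
is never broken by an optimal clustering. -/
theorem atom_not_broken_by_optimum
    (plus : V → V → Bool) (hsym : ∀ a b : V, plus a b = plus b a)
    (K : Finset V) (hK : 2 ≤ K.card)
    (hdense : ∀ u ∈ K, (((NPlus plus u) ∆ K).card : ℝ) < 0.1 * K.card)
    (P : Finpartition (univ : Finset V))
    (hmin : ∀ Q : Finpartition (univ : Finset V), objClust plus P ≤ objClust plus Q) :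
    ∃ t ∈ P.parts, K ⊆ t := by
  have hd : ∀ u ∈ K, ∑ b ∈ K, (1 - nbrInd plus u b) + ∑ b ∈ Kᶜ, nbrInd plus u b <
      0.1 * K.card := fun u hu => card_symmDiff_eq_sum plus K u ▸ hdense u hu
  have hn0 : ∀ u b, 0 ≤ nbrInd plus u b := fun u b => (nbrInd_mem_Icc plus u b).1
  have hn1 : ∀ u b, nbrInd plus u b ≤ 1 := fun u b => (nbrInd_mem_Icc plus u b).2
  have hs0 : ∀ u b, 0 ≤ sameInd P u b := fun u b => (sameInd_mem_Icc P u b).1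
  have hs1 : ∀ u b, sameInd P u b ≤ 1 := fun u b => (sameInd_mem_Icc P u b).2
  have hdm : ∀ u, 0 ≤ ∑ b ∈ K, (1 - nbrInd plus u b) := fun u =>
    sum_nonneg fun b _ => sub_nonneg.2 (hn1 u b)
  have hdp : ∀ u, 0 ≤ ∑ b ∈ Kᶜ, nbrInd plus u b := fun u => sum_nonneg fun b _ => hn0 u b
  obtain ⟨a, haK, ha⟩ : ∃ a ∈ K, ∑ b ∈ K, pairSign plus a b * (1 - sameInd P a b) ≤
      2 * ∑ b ∈ Kᶜ, pairSign plus a b * sameInd P a b := by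
    refine exists_le_of_sum_le (card_pos.1 (by omega)) ?_
    rw [← mul_sum]
    exact carve_le plus hsym P hmin K
  have hk : ∑ b ∈ K, (1 - sameInd P a b) = K.card - ∑ b ∈ K, sameInd P a b := by simp
  have ha1 : ∑ b ∈ K, (1 - sameInd P a b) - 2 * ∑ b ∈ K, (1 - nbrInd plus a b) ≤
      ∑ b ∈ K, pairSign plus a b * (1 - sameInd P a b) := by
    rw [mul_sum, ← sum_sub_distrib]
    refine sum_le_sum fun b _ => ?_
    rcases eq_or_ne b a with rfl | hb
    · linarith [sameInd_self P b, hn1 b b, mul_eq_zero_of_right (pairSign plus b b)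
        (sub_eq_zero.2 (sameInd_self P b).symm)]
    · rw [pairSign_eq_of_ne plus hb]
      nlinarith [mul_nonneg (sub_nonneg.2 (hn1 a b)) (hs0 a b)]
  have ha2 : ∑ b ∈ Kᶜ, pairSign plus a b * sameInd P a b ≤
      2 * ∑ b ∈ Kᶜ, nbrInd plus a b - ∑ b ∈ Kᶜ, sameInd P a b := by
    rw [mul_sum, ← sum_sub_distrib]
    refine sum_le_sum fun b hb => ?_
    have hba : b ≠ a := fun h => mem_compl.1 hb (h ▸ haK)
    rw [pairSign_eq_of_ne plus hba]
    nlinarith [mul_nonneg (sub_nonneg.2 (hs1 a b)) (hn0 a b)]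
  have hy : 0 ≤ ∑ b ∈ Kᶜ, sameInd P a b := sum_nonneg fun b _ => hs0 a b
  refine ⟨P.part a, P.part_mem.2 (mem_univ a), fun u hu => ?_⟩
  by_contra hua
  have hne : ¬ SamePart P a u := by
    rw [samePart_iff_part_eq]
    exact fun h => hua (h ▸ P.mem_part (mem_univ u))
  have hmv := move_le plus hsym P hmin a u hne
  rw [← sum_add_sum_compl K, ← sum_add_sum_compl K (fun b => pairSign plus u b * sameInd P u b)]
    at hmv
  have hau : sameInd P a u = 0 := if_neg hne
  have m1 : ∑ b ∈ K, sameInd P a b - 2 * ∑ b ∈ K, (1 - nbrInd plus u b) ≤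
      ∑ b ∈ K, pairSign plus u b * sameInd P a b := by
    rw [mul_sum, ← sum_sub_distrib]
    refine sum_le_sum fun b _ => ?_
    rcases eq_or_ne b u with rfl | hb
    · rw [hau]
      linarith [hn1 b b]
    · rw [pairSign_eq_of_ne plus hb]
      nlinarith [mul_nonneg (sub_nonneg.2 (hn1 u b)) (sub_nonneg.2 (hs1 a b))]
  have m2 : -∑ b ∈ Kᶜ, sameInd P a b ≤ ∑ b ∈ Kᶜ, pairSign plus u b * sameInd P a b := by
    rw [← sum_neg_distrib]
    exact sum_le_sum fun b _ => by nlinarith [neg_one_le_pairSign plus u b, hs0 a b]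
  have hdisj : ∀ b, sameInd P u b ≤ 1 - sameInd P a b := by
    intro b
    rw [samePart_iff_part_eq] at hne
    unfold sameInd
    simp only [samePart_iff_part_eq]
    split_ifs with h1 h2 <;> norm_num
    exact hne (h2.trans h1.symm)
  have m3 : ∑ b ∈ K, pairSign plus u b * sameInd P u b ≤ ∑ b ∈ K, (1 - sameInd P a b) :=
    sum_le_sum fun b _ => by nlinarith [pairSign_le_one plus u b, hs0 u b, hdisj b]
  have m4 : ∑ b ∈ Kᶜ, pairSign plus u b * sameInd P u b ≤ ∑ b ∈ Kᶜ, nbrInd plus u b := by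
    refine sum_le_sum fun b hb => ?_
    have hbu : b ≠ u := fun h => mem_compl.1 hb (h ▸ hu)
    rw [pairSign_eq_of_ne plus hbu]
    nlinarith [mul_nonneg (sub_nonneg.2 (hs1 u b)) (hn0 u b),
      mul_nonneg (sub_nonneg.2 (hn1 u b)) (hs0 u b)]
  linarith [hd a haK, hd u hu, hdm a, hdp a, hdm u, hdp u]
end

section
/- In the averaged preclustered setting, let ε ∈ (0,1) and let C ⊆ V be a union of atoms such that for every u ∈ C with K_u ≠ C one has w(u, C) > |C|/2 + ε·w_u. Then for every u, v ∈ C one has w_u > ε·w_v. -/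
open Finset
open scoped Classical

variable {V : Type*} [Fintype V] [DecidableEq V]

/-- The weight `w_{uv}`: the fraction of pairs between the atoms of `u` and `v`
that are `+`pairs (with `u' = v'` counted as a `+`pair). -/
noncomputable def wgt (plus : V → V → Bool) (Katom : V → Finset V) (u v : V) : ℝ :=
  (((Katom u ×ˢ Katom v).filter (fun p => p.1 = p.2 ∨ plus p.1 p.2 = true)).card : ℝ) /
    (((Katom u).card : ℝ) * ((Katom v).card : ℝ))

/-- `w(u, A) := ∑_{v ∈ A} w_{uv}`. -/
noncomputable def wSet (plus : V → V → Bool) (Katom : V → Finset V) (u : V) (A : Finset V) : ℝ :=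
  ∑ v ∈ A, wgt plus Katom u v

/-- `w_u := w(u, V)`. -/
noncomputable def wTot (plus : V → V → Bool) (Katom : V → Finset V) (u : V) : ℝ :=
  wSet plus Katom u univ

theorem wgt_nonneg (plus : V → V → Bool) (Katom : V → Finset V) (u v : V) :
    0 ≤ wgt plus Katom u v := by
  unfold wgt
  positivity

theorem wgt_le_one (plus : V → V → Bool) (Katom : V → Finset V) (u v : V) :
    wgt plus Katom u v ≤ 1 := by
  unfold wgt
  refine div_le_one_of_le₀ ?_ (by positivity)
  rw [← Nat.cast_mul, ← Finset.card_product]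
  exact_mod_cast Finset.card_filter_le _ _

theorem wgt_self_pos (plus : V → V → Bool) (Katom : V → Finset V) (u : V)
    (hu : u ∈ Katom u) : 0 < wgt plus Katom u u := by
  have hcard : 0 < (Katom u).card := Finset.card_pos.mpr ⟨u, hu⟩
  unfold wgt
  refine div_pos (Nat.cast_pos.mpr (Finset.card_pos.mpr ⟨(u, u), ?_⟩)) (by positivity)
  simp [hu]

theorem wSet_le_card (plus : V → V → Bool) (Katom : V → Finset V) (u : V) (A : Finset V) :
    wSet plus Katom u A ≤ A.card := by
  simpa [wSet] using Finset.sum_le_card_nsmul A (wgt plus Katom u) 1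
    fun v _ => wgt_le_one plus Katom u v

theorem wSet_le_wTot (plus : V → V → Bool) (Katom : V → Finset V) (u : V) (A : Finset V) :
    wSet plus Katom u A ≤ wTot plus Katom u :=
  Finset.sum_le_sum_of_subset_of_nonneg (Finset.subset_univ A)
    fun v _ _ => wgt_nonneg plus Katom u v

theorem wTot_pos (plus : V → V → Bool) (Katom : V → Finset V) (u : V)
    (hu : u ∈ Katom u) : 0 < wTot plus Katom u :=
  Finset.sum_pos' (fun v _ => wgt_nonneg plus Katom u v)
    ⟨u, Finset.mem_univ u, wgt_self_pos plus Katom u hu⟩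

theorem wTot_congr (plus : V → V → Bool) (Katom : V → Finset V) {u v : V}
    (h : Katom u = Katom v) : wTot plus Katom u = wTot plus Katom v := by
  simp only [wTot, wSet, wgt, h]

theorem degrees_close_in_cluster
    (plus : V → V → Bool) (hsym : ∀ a b : V, plus a b = plus b a)
    (Katom : V → Finset V)
    (hmem : ∀ u : V, u ∈ Katom u)
    (hpart : ∀ u v : V, v ∈ Katom u → Katom v = Katom u)
    (hatomplus : ∀ u v : V, v ∈ Katom u → u ≠ v → plus u v = true)
    (ε : ℝ) (hε : ε ∈ Set.Ioo (0 : ℝ) 1)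
    (C : Finset V) (hCatoms : ∀ u ∈ C, Katom u ⊆ C)
    (hbig : ∀ u ∈ C, Katom u ≠ C →
        (C.card : ℝ) / 2 + ε * wTot plus Katom u < wSet plus Katom u C) :
    ∀ u ∈ C, ∀ v ∈ C, ε * wTot plus Katom v < wTot plus Katom u := by
  intro u hu v hv
  have hpos := wTot_pos plus Katom u (hmem u)
  by_cases heq : Katom u = Katom v
  · rw [← wTot_congr plus Katom heq]
    exact mul_lt_of_lt_one_left hpos hε.2
  · have hKu : Katom u ≠ C := fun h => heq (hpart u v (h ▸ hv)).symm
    have hKv : Katom v ≠ C := fun h => heq (hpart v u (h ▸ hu))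
    have hu_big := hbig u hu hKu
    have hv_big := hbig v hv hKv
    have hv_le := wSet_le_card plus Katom v C
    have hu_le := wSet_le_wTot plus Katom u C
    have hu_pos := mul_pos hε.1 hpos
    linarith
end

section
/- In the averaged preclustered setting, let ε ∈ (0,1) and let C ⊆ V be a union of atoms such that for every u ∈ C with K_u ≠ C one has w(u, C) > |C|/2 + ε·w_u. Then for every u, v ∈ C with v ∉ K_u, the sum over p ∈ N^1_u ∩ N^1_v of w_{up}·w_{vp} is strictly greater than ε·(w_u + w_v). -/
open Finset
open scoped Classical

variable {V : Type*} [Fintype V] [DecidableEq V]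

/-- `N^1_u`: the neighbors of `u` in `E^1`, i.e. vertices `v` with `ε·w_v < w_u < w_v/ε`. -/
noncomputable def N1 (plus : V → V → Bool) (Katom : V → Finset V) (ε : ℝ) (u : V) : Finset V :=
  univ.filter (fun v =>
    ε * wTot plus Katom v < wTot plus Katom u ∧ wTot plus Katom u < wTot plus Katom v / ε)

theorem large_common_weighted_neighborhood
    (plus : V → V → Bool) (hsym : ∀ a b : V, plus a b = plus b a)
    (Katom : V → Finset V)
    (hmem : ∀ u : V, u ∈ Katom u)
    (hpart : ∀ u v : V, v ∈ Katom u → Katom v = Katom u)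
    (hatomplus : ∀ u v : V, v ∈ Katom u → u ≠ v → plus u v = true)
    (ε : ℝ) (hε : ε ∈ Set.Ioo (0 : ℝ) 1)
    (C : Finset V) (hCatoms : ∀ u ∈ C, Katom u ⊆ C)
    (hbig : ∀ u ∈ C, Katom u ≠ C →
        (C.card : ℝ) / 2 + ε * wTot plus Katom u < wSet plus Katom u C) :
    ∀ u ∈ C, ∀ v ∈ C, v ∉ Katom u →
      ε * (wTot plus Katom u + wTot plus Katom v) <
        ∑ p ∈ N1 plus Katom ε u ∩ N1 plus Katom ε v,
          wgt plus Katom u p * wgt plus Katom v p := by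
  obtain ⟨hε0, -⟩ := hε
  intro u hu v hv huv
  have hne : ∀ p ∈ C, Katom p ≠ C := by
    intro p _ h
    have h1 := hpart p u (h ▸ hu)
    exact huv (by rw [h1, h]; exact hv)
  have hlt : ∀ p ∈ C, ∀ q ∈ C, ε * wTot plus Katom q < wTot plus Katom p := by
    intro p hp q hq
    have h1 := hbig p hp (hne p hp)
    have h2 := hbig q hq (hne q hq)
    have h3 := wSet_le_card plus Katom q C
    have h4 := wSet_le_wTot plus Katom p C
    have h5 : 0 ≤ wTot plus Katom p := Finset.sum_nonneg fun x _ => wgt_nonneg plus Katom p x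
    have h6 := mul_nonneg hε0.le h5
    linarith
  have hN : ∀ p ∈ C, C ⊆ N1 plus Katom ε p := by
    intro p hp q hq
    simp only [N1, Finset.mem_filter, Finset.mem_univ, true_and]
    refine ⟨hlt p hp q hq, ?_⟩
    rw [lt_div_iff₀ hε0, mul_comm]
    exact hlt q hq p hp
  have hu' := hbig u hu (hne u hu)
  have hv' := hbig v hv (hne v hv)
  calc ε * (wTot plus Katom u + wTot plus Katom v)
      < wSet plus Katom u C + wSet plus Katom v C - C.card := by linarith
    _ = ∑ p ∈ C, (wgt plus Katom u p + wgt plus Katom v p - 1) := by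
        simp [wSet, Finset.sum_add_distrib, Finset.sum_sub_distrib]
    _ ≤ ∑ p ∈ C, wgt plus Katom u p * wgt plus Katom v p := by
        refine Finset.sum_le_sum fun p _ => ?_
        nlinarith [wgt_le_one plus Katom u p, wgt_le_one plus Katom v p]
    _ ≤ _ := Finset.sum_le_sum_of_subset_of_nonneg
        (Finset.subset_inter (hN u hu) (hN v hv))
        fun p _ _ => mul_nonneg (wgt_nonneg plus Katom u p) (wgt_nonneg plus Katom v p)
end

section
/- There exists a constant c > 0 such that for every ε ∈ (0,1] and every monotone nonincreasing function f : [0,1] → [0,1] satisfying, for all y ∈ [0,1], ∫₀^y f(x) dx ≤ y − y² + y³/3 + ε/3, one has ∫₀¹ f(x)² dx ≤ 1/5 + c·√ε. -/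
open MeasureTheory Set

theorem AntitoneOn.exists_setOf_lt_ae_eq_Ioc {f : ℝ → ℝ} {a b : ℝ} (hab : a ≤ b)
    (hf : AntitoneOn f (Icc a b)) (t : ℝ) :
    ∃ y ∈ Icc a b, (Ioc a b ∩ {x | t < f x} : Set ℝ) =ᵐ[volume] Ioc a y := by
  set S : Set ℝ := Ioc a b ∩ {x | t < f x} with hS
  have hbdd : BddAbove (insert a S) :=
    ⟨b, by rintro x (rfl | hx); exacts [hab, hx.1.2]⟩
  have hne : (insert a S).Nonempty := ⟨a, mem_insert _ _⟩
  refine ⟨sSup (insert a S), ⟨le_csSup hbdd (mem_insert _ _), csSup_le hne ?_⟩, ?_⟩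
  · rintro x (rfl | hx)
    exacts [hab, hx.1.2]
  refine Filter.EventuallyLE.antisymm ?_ ?_
  · exact LE.le.eventuallyLE fun x hx => ⟨hx.1.1, le_csSup hbdd (mem_insert_of_mem _ hx)⟩
  · refine Ioo_ae_eq_Ioc.symm.le.trans (LE.le.eventuallyLE ?_)
    rintro x ⟨hax, hx⟩
    obtain ⟨z, hz, hxz⟩ := exists_lt_of_lt_csSup hne hx
    rcases hz with rfl | ⟨hz, htz⟩
    · exact absurd hxz hax.not_gt
    · have hxb : x ≤ b := hxz.le.trans hz.2
      exact ⟨⟨hax, hxb⟩, lt_of_lt_of_le htz (hf ⟨hax.le, hxb⟩ ⟨hz.1.le, hz.2⟩ hxz.le)⟩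

/-- If all the initial integrals of `h` are at most `C`, then so is the integral of `h` against a
nonincreasing weight with values in the unit interval. -/
theorem AntitoneOn.integral_mul_le {f h : ℝ → ℝ} {a b C : ℝ} (hab : a ≤ b)
    (hf : AntitoneOn f (Icc a b)) (hf01 : ∀ x ∈ Icc a b, f x ∈ Icc (0 : ℝ) 1)
    (hh : IntervalIntegrable h volume a b) (hC : ∀ y ∈ Icc a b, ∫ x in a..y, h x ≤ C) :
    ∫ x in a..b, f x * h x ≤ C := by
  have hfm : AEMeasurable f (volume.restrict (Ioc a b)) :=
    aemeasurable_restrict_of_antitoneOn measurableSet_Ioc (hf.mono Ioc_subset_Icc_self)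
  have hhi : Integrable h (volume.restrict (Ioc a b)) :=
    (intervalIntegrable_iff_integrableOn_Ioc_of_le hab).1 hh
  have hint : Integrable (Function.uncurry fun x t : ℝ => (Iio (f x)).indicator (fun _ => h x) t)
      ((volume.restrict (Ioc a b)).prod (volume.restrict (Ioc (0 : ℝ) 1))) := by
    have hset : NullMeasurableSet {p : ℝ × ℝ | p.2 < f p.1}
        ((volume.restrict (Ioc a b)).prod (volume.restrict (Ioc (0 : ℝ) 1))) :=
      nullMeasurableSet_lt measurable_snd.aemeasurable hfm.comp_fst
    have := (hhi.comp_fst (volume.restrict (Ioc (0 : ℝ) 1))).indicator₀ hset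
    refine this.congr (Filter.Eventually.of_forall ?_)
    rintro ⟨x, t⟩
    simp [indicator, Function.uncurry]
  have hlayer : ∀ x ∈ Ioc a b,
      ∫ t in Ioc (0 : ℝ) 1, (Iio (f x)).indicator (fun _ => h x) t = f x * h x := by
    intro x hx
    obtain ⟨h0, h1⟩ := hf01 x (Ioc_subset_Icc_self hx)
    have hae : (Ioc (0 : ℝ) 1 ∩ Iio (f x) : Set ℝ) =ᵐ[volume] Ioc 0 (f x) := by
      have : (Ioc (0 : ℝ) 1 ∩ Iio (f x) : Set ℝ) = Ioo 0 (f x) := by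
        ext t
        simp only [mem_inter_iff, mem_Ioc, mem_Iio, mem_Ioo]
        exact ⟨fun ht => ⟨ht.1.1, ht.2⟩, fun ht => ⟨⟨ht.1, ht.2.le.trans h1⟩, ht.2⟩⟩
      rw [this]
      exact Ioo_ae_eq_Ioc
    rw [setIntegral_indicator measurableSet_Iio, setIntegral_congr_set hae,
      ← intervalIntegral.integral_of_le h0]
    simp
  have hlevel : ∀ t : ℝ, ∫ x in Ioc a b, (Iio (f x)).indicator (fun _ => h x) t ≤ C := by
    intro t
    obtain ⟨y, hy, hae⟩ := hf.exists_setOf_lt_ae_eq_Ioc hab t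
    have heq : (fun x => (Iio (f x)).indicator (fun _ => h x) t)
        = {x | t < f x}.indicator h := by
      ext x
      simp [indicator]
    have hnull : NullMeasurableSet {x | t < f x} (volume.restrict (Ioc a b)) :=
      nullMeasurableSet_lt aemeasurable_const hfm
    rw [heq, integral_indicator₀ hnull, Measure.restrict_restrict₀ hnull, inter_comm,
      setIntegral_congr_set hae, ← intervalIntegral.integral_of_le hy.1]
    exact hC y hy
  rw [intervalIntegral.integral_of_le hab, ← setIntegral_congr_fun measurableSet_Ioc hlayer,
    integral_integral_swap hint]
  calc _ ≤ ∫ _ in Ioc (0 : ℝ) 1, C :=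
        integral_mono hint.integral_prod_right (integrable_const C) hlevel
    _ = C := by simp

theorem integral_one_sub_sq (y : ℝ) :
    ∫ x in (0 : ℝ)..y, (1 - x) ^ 2 = y - y ^ 2 + y ^ 3 / 3 := by
  rw [intervalIntegral.integral_comp_sub_left (fun x => x ^ 2), integral_pow]
  norm_num
  ring

theorem integral_one_sub_sq_mul_self :
    ∫ x in (0 : ℝ)..1, (1 - x) ^ 2 * (1 - x) ^ 2 = 1 / 5 := by
  have h : ∀ x : ℝ, (1 - x) ^ 2 * (1 - x) ^ 2 = (1 - x) ^ 4 := fun x => by ring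
  simp_rw [h]
  rw [intervalIntegral.integral_comp_sub_left (fun x => x ^ 4), integral_pow]
  norm_num

theorem integral_sq_bound_of_cubic_constraint :
    ∃ c : ℝ, 0 < c ∧
      ∀ ε : ℝ, ε ∈ Set.Ioc (0 : ℝ) 1 →
        ∀ f : ℝ → ℝ,
          (∀ x ∈ Set.Icc (0 : ℝ) 1, f x ∈ Set.Icc (0 : ℝ) 1) →
          AntitoneOn f (Set.Icc (0 : ℝ) 1) →
          (∀ y ∈ Set.Icc (0 : ℝ) 1,
              (∫ x in (0 : ℝ)..y, f x) ≤ y - y ^ 2 + y ^ 3 / 3 + ε / 3) →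
          (∫ x in (0 : ℝ)..1, (f x) ^ 2) ≤ 1 / 5 + c * Real.sqrt ε := by
  refine ⟨1, one_pos, fun ε ⟨hε0, hε1⟩ f hf01 hf hbound => ?_⟩
  have hg : AntitoneOn (fun x : ℝ => (1 - x) ^ 2) (Icc 0 1) := fun x _ y hy hxy =>
    pow_le_pow_left₀ (sub_nonneg.2 hy.2) (sub_le_sub_left hxy 1) 2
  have hg01 : ∀ x ∈ Icc (0 : ℝ) 1, (1 - x) ^ 2 ∈ Icc (0 : ℝ) 1 := fun x hx =>
    ⟨sq_nonneg _, pow_le_one₀ (sub_nonneg.2 hx.2) (sub_le_self 1 hx.1)⟩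
  have hfi : IntervalIntegrable f volume 0 1 := by
    apply AntitoneOn.intervalIntegrable
    rwa [uIcc_of_le zero_le_one]
  have hgc : Continuous fun x : ℝ => (1 - x) ^ 2 := by fun_prop
  have hgi : ∀ y : ℝ, IntervalIntegrable (fun x : ℝ => (1 - x) ^ 2) volume 0 y :=
    fun y => hgc.intervalIntegrable 0 y
  have hdiff : ∀ y ∈ Icc (0 : ℝ) 1, ∫ x in (0 : ℝ)..y, (f x - (1 - x) ^ 2) ≤ ε / 3 := by
    intro y hy
    have hfy : IntervalIntegrable f volume 0 y := by
      refine hfi.mono_set ?_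
      rw [uIcc_of_le hy.1, uIcc_of_le zero_le_one]
      exact Icc_subset_Icc_right hy.2
    rw [intervalIntegral.integral_sub hfy (hgi y), integral_one_sub_sq]
    linarith [hbound y hy]
  have hff : IntervalIntegrable (fun x => f x ^ 2) volume 0 1 := by
    apply AntitoneOn.intervalIntegrable
    rw [uIcc_of_le zero_le_one]
    exact fun x hx y hy hxy => pow_le_pow_left₀ (hf01 y hy).1 (hf hx hy hxy) 2
  have hgf : IntervalIntegrable (fun x => (1 - x) ^ 2 * f x) volume 0 1 :=
    hfi.continuousOn_mul hgc.continuousOn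
  have h1 := hf.integral_mul_le zero_le_one hf01 (hfi.sub (hgi 1)) hdiff
  have h2 := hg.integral_mul_le zero_le_one hg01 (hfi.sub (hgi 1)) hdiff
  have e1 : ∫ x in (0 : ℝ)..1, f x * (f x - (1 - x) ^ 2)
      = (∫ x in (0 : ℝ)..1, f x ^ 2) - ∫ x in (0 : ℝ)..1, (1 - x) ^ 2 * f x := by
    rw [← intervalIntegral.integral_sub hff hgf]
    congr 1 with x
    ring
  have e2 : ∫ x in (0 : ℝ)..1, (1 - x) ^ 2 * (f x - (1 - x) ^ 2)
      = (∫ x in (0 : ℝ)..1, (1 - x) ^ 2 * f x) - 1 / 5 := by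
    rw [← integral_one_sub_sq_mul_self,
      ← intervalIntegral.integral_sub hgf ((hgi 1).continuousOn_mul hgc.continuousOn)]
    congr 1 with x
    ring
  have hsqrt : ε ≤ √ε := Real.le_sqrt_of_sq_le (by nlinarith)
  linarith
end
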